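/- arXiv:1911.10399 — 2 statements merged into one kernel-verified Lean document; each statement's English description precedes it below -/
import Mathlib

section
/- Let E_n be open sets in 𝕋^d and let μ_n be finite Borel measures with μ_n(𝕋^d \ E_n) = 0 such that each μ_n is absolutely continuous with respect to Lebesgue measure λ. Suppose there is a constant C such that, for every ball B in 𝕋^d, C^{−1} ≤ liminf_{n→∞} μ_n(B)/λ(B) ≤ limsup_{n→∞} μ_n(B)/λ(B) ≤ C, and such that ∬ |x−y|^{−s} dμ_n(x) dμ_n(y) < C for all n. Then limsup_{n→∞} E_n belongs to 𝒢^s(𝕋^d), and in particular dim_H limsup_{n→∞} E_n ≥ s. -/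
open MeasureTheory Metric Filter Set
open scoped ENNReal Topology

noncomputable section

/-- The `d`-dimensional torus `ℝ^d / ℤ^d`. -/
abbrev Torus (d : ℕ) := Fin d → AddCircle (1 : ℝ)

/-- The canonical projection `ℝ^d → 𝕋^d`. -/
def torusProj {d : ℕ} (y : Fin d → ℝ) : Torus d := fun i => (y i : AddCircle (1 : ℝ))

/-- A dyadic cube in the torus: the image under the projection `ℝ^d → 𝕋^d` of a product
of intervals `[kᵢ 2^{-n}, (kᵢ+1) 2^{-n})`. -/
def IsDyadicCube {d : ℕ} (D : Set (Torus d)) : Prop :=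
  ∃ (n : ℕ) (k : Fin d → ℤ),
    D = torusProj ''
      (Set.univ.pi fun i => Set.Ico ((k i : ℝ) / 2 ^ n) (((k i : ℝ) + 1) / 2 ^ n))

/-- The outer dyadic content `ℳ_∞^t(E) = inf { Σ_k |D_k|^t : E ⊆ ⋃_k D_k, D_k dyadic }`. -/
noncomputable def dyadicContent {d : ℕ} (t : ℝ) (E : Set (Torus d)) : ℝ≥0∞ :=
  ⨅ (f : ℕ → Set (Torus d)) (_ : ∀ n, IsDyadicCube (f n)) (_ : E ⊆ ⋃ n, f n),
    ∑' n, EMetric.diam (f n) ^ t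

/-- Falconer's class `𝒢^s(𝕋^d)` of sets with large intersections: `G_δ` sets `E` with
`ℳ_∞^t(E ∩ D) ≥ |D|^t` for all dyadic cubes `D` and all `t < s`. -/
def MemLargeIntersectionClass {d : ℕ} (s : ℝ) (E : Set (Torus d)) : Prop :=
  IsGδ E ∧ ∀ D : Set (Torus d), IsDyadicCube D → ∀ t : ℝ, t < s →
    EMetric.diam D ^ t ≤ dyadicContent t (E ∩ D)

/-- The representative in `[0, 1)` of a point of the circle. -/
def circleRep (u : AddCircle (1 : ℝ)) : ℝ := (AddCircle.equivIco (1 : ℝ) 0 u : ℝ)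

lemma circleRep_coe (y : ℝ) : circleRep (y : AddCircle (1 : ℝ)) = Int.fract y := by
  simp [circleRep, AddCircle.coe_equivIco_mk_apply]

lemma coe_circleRep (u : AddCircle (1 : ℝ)) : (circleRep u : AddCircle (1 : ℝ)) = u :=
  (AddCircle.equivIco (1 : ℝ) 0).symm_apply_apply u

lemma measurable_circleRep : Measurable circleRep :=
  measurable_subtype_coe.comp (AddCircle.measurableEquivIco (1 : ℝ) 0).measurable

section Cells

variable {d : ℕ}

lemma torusProj_circleRep (x : Torus d) : torusProj (fun i => circleRep (x i)) = x :=
  funext fun i => coe_circleRep (x i)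

/-- The index of the dyadic cube of side `2^{-j}` containing a point. -/
def cellIdx (j : ℕ) (x : Torus d) : Fin d → ℤ := fun i => ⌊(2 : ℝ) ^ j * circleRep (x i)⌋

/-- The dyadic cube of side `2^{-j}` with index `k`; empty if some `k i` is not in `[0, 2^j)`. -/
def cell (j : ℕ) (k : Fin d → ℤ) : Set (Torus d) := cellIdx j ⁻¹' {k}

lemma mem_cell {j : ℕ} {k : Fin d → ℤ} {x : Torus d} : x ∈ cell j k ↔ cellIdx j x = k := Iff.rfl

lemma mem_cell_cellIdx (j : ℕ) (x : Torus d) : x ∈ cell j (cellIdx j x) := rfl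

lemma measurable_cellIdx (j : ℕ) : Measurable (cellIdx j : Torus d → Fin d → ℤ) := by
  refine measurable_pi_lambda _ fun i => Int.measurable_floor.comp ?_
  exact (measurable_circleRep.comp (measurable_pi_apply i)).const_mul _

lemma measurableSet_cell (j : ℕ) (k : Fin d → ℤ) : MeasurableSet (cell j k) :=
  measurable_cellIdx j (measurableSet_singleton k)

lemma cellIdx_torusProj (j : ℕ) (y : Fin d → ℝ) (i : Fin d) :
    cellIdx j (torusProj y) i = ⌊(2 : ℝ) ^ j * y i⌋ % 2 ^ j := by
  have h1 : (2 : ℝ) ^ j * Int.fract (y i)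
      = 2 ^ j * y i - ((2 ^ j * ⌊y i⌋ : ℤ) : ℝ) := by
    push_cast; rw [Int.fract]; ring
  have h2 : ⌊y i⌋ = ⌊(2 : ℝ) ^ j * y i⌋ / 2 ^ j := by
    have := Int.floor_div_natCast ((2 : ℝ) ^ j * y i) (2 ^ j)
    push_cast at this
    rw [← this, mul_div_cancel_left₀]
    positivity
  simp only [cellIdx, torusProj, circleRep_coe, h1, Int.floor_sub_intCast]
  rw [Int.emod_def, h2]

lemma cellIdx_eq_ediv {j q : ℕ} (h : j ≤ q) (x : Torus d) (i : Fin d) :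
    cellIdx j x i = cellIdx q x i / 2 ^ (q - j) := by
  have := Int.floor_div_natCast ((2 : ℝ) ^ q * circleRep (x i)) (2 ^ (q - j))
  push_cast at this
  rw [cellIdx, cellIdx, ← this]
  congr 1
  rw [eq_div_iff (by positivity), mul_right_comm, ← pow_add, Nat.add_sub_cancel' h]

lemma cellIdx_congr {j q : ℕ} (h : j ≤ q) {x x' : Torus d} (hx : cellIdx q x = cellIdx q x') :
    cellIdx j x = cellIdx j x' := by
  ext i
  rw [cellIdx_eq_ediv h, cellIdx_eq_ediv h, hx]

lemma cell_subset_or_disjoint {j q : ℕ} (h : j ≤ q) (k l : Fin d → ℤ) :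
    cell q k ⊆ cell j l ∨ Disjoint (cell q k) (cell j l) := by
  by_cases hne : (cell q k ∩ cell j l).Nonempty
  · obtain ⟨x, hx, hx'⟩ := hne
    left
    intro y hy
    rw [mem_cell] at *
    rw [← hx', cellIdx_congr h (hy.trans hx.symm)]
  · right
    rwa [Set.not_nonempty_iff_eq_empty, ← Set.disjoint_iff_inter_eq_empty] at hne

/-- The indices of the nonempty dyadic cubes of side `2^{-j}`. -/
def cellIndices (d j : ℕ) : Finset (Fin d → ℤ) := Fintype.piFinset fun _ => Finset.Ico 0 (2 ^ j)

lemma cellIdx_mem_cellIndices (j : ℕ) (x : Torus d) : cellIdx j x ∈ cellIndices d j := by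
  rw [cellIndices, Fintype.mem_piFinset]
  intro i
  rw [← torusProj_circleRep x, cellIdx_torusProj, Finset.mem_Ico]
  exact ⟨Int.emod_nonneg _ (by positivity), Int.emod_lt_of_pos _ (by positivity)⟩

lemma mem_Ico_div_iff (j : ℕ) (k : ℤ) (y : ℝ) :
    y ∈ Set.Ico ((k : ℝ) / 2 ^ j) (((k : ℝ) + 1) / 2 ^ j) ↔ ⌊(2 : ℝ) ^ j * y⌋ = k := by
  rw [Int.floor_eq_iff, Set.mem_Ico, div_le_iff₀' (by positivity), lt_div_iff₀' (by positivity)]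

lemma torusProj_image_eq_cell (j : ℕ) (k : Fin d → ℤ) :
    torusProj '' (Set.univ.pi fun i => Set.Ico ((k i : ℝ) / 2 ^ j) (((k i : ℝ) + 1) / 2 ^ j))
      = cell j fun i => k i % 2 ^ j := by
  ext x
  simp only [Set.mem_image, Set.mem_univ_pi, mem_Ico_div_iff, mem_cell]
  constructor
  · rintro ⟨y, hy, rfl⟩
    ext i
    rw [cellIdx_torusProj, hy]
  · intro hx
    refine ⟨fun i => circleRep (x i) + ((k i / 2 ^ j : ℤ) : ℝ), fun i => ?_, ?_⟩
    · have h1 : (2 : ℝ) ^ j * (circleRep (x i) + ((k i / 2 ^ j : ℤ) : ℝ))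
          = 2 ^ j * circleRep (x i) + ((2 ^ j * (k i / 2 ^ j) : ℤ) : ℝ) := by
        push_cast; ring
      rw [h1, Int.floor_add_intCast]
      have := congrFun hx i
      simp only [cellIdx] at this
      rw [this, Int.emod_add_mul_ediv]
    · ext i
      have : (((k i / 2 ^ j : ℤ) : ℝ) : AddCircle (1 : ℝ)) = 0 :=
        (AddCircle.coe_eq_zero_iff (1 : ℝ)).2 ⟨k i / 2 ^ j, by simp⟩
      simp only [torusProj, AddCircle.coe_add, this, coe_circleRep, add_zero]

lemma cell_eq_image {j : ℕ} {k : Fin d → ℤ} (h : k ∈ cellIndices d j) :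
    cell j k = torusProj ''
      (Set.univ.pi fun i => Set.Ico ((k i : ℝ) / 2 ^ j) (((k i : ℝ) + 1) / 2 ^ j)) := by
  rw [torusProj_image_eq_cell]
  congr 1
  ext i
  rw [cellIndices, Fintype.mem_piFinset] at h
  have := Finset.mem_Ico.1 (h i)
  exact (Int.emod_eq_of_lt this.1 this.2).symm

lemma isDyadicCube_iff {D : Set (Torus d)} :
    IsDyadicCube D ↔ ∃ (j : ℕ) (k : Fin d → ℤ), k ∈ cellIndices d j ∧ D = cell j k := by
  constructor
  · rintro ⟨j, k, rfl⟩
    refine ⟨j, _, ?_, torusProj_image_eq_cell j k⟩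
    rw [cellIndices, Fintype.mem_piFinset]
    intro i
    rw [Finset.mem_Ico]
    exact ⟨Int.emod_nonneg _ (by positivity), Int.emod_lt_of_pos _ (by positivity)⟩
  · rintro ⟨j, k, hk, rfl⟩
    exact ⟨j, k, cell_eq_image hk⟩

lemma isDyadicCube_cell (j : ℕ) (x : Torus d) : IsDyadicCube (cell j (cellIdx j x)) :=
  isDyadicCube_iff.2 ⟨j, _, cellIdx_mem_cellIndices j x, rfl⟩

/-- The common center of the dyadic cube `cell j k` and of its interior. -/
def cellCenter (j : ℕ) (k : Fin d → ℤ) : Torus d :=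
  torusProj fun i => ((k i : ℝ) + 1 / 2) / 2 ^ j

/-- The union of the boundaries of the dyadic cubes of side `2^{-j}`. -/
def gridBoundary (d j : ℕ) : Set (Torus d) := {x | ∃ i, (2 ^ j : ℕ) • x i = 0}

lemma isClosed_gridBoundary (j : ℕ) : IsClosed (gridBoundary d j) := by
  have : gridBoundary d j = ⋃ i, {x : Torus d | (2 ^ j : ℕ) • x i = 0} := by
    ext x; simp [gridBoundary]
  rw [this]
  exact isClosed_iUnion_of_finite fun i => isClosed_eq (by fun_prop) continuous_const

lemma gridBoundary_mono {j q : ℕ} (h : j ≤ q) : gridBoundary d j ⊆ gridBoundary d q := by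
  rintro x ⟨i, hi⟩
  refine ⟨i, ?_⟩
  obtain ⟨r, rfl⟩ := Nat.exists_eq_add_of_le h
  rw [pow_add, mul_comm, mul_smul, hi, smul_zero]

lemma volume_gridBoundary (j : ℕ) : volume (gridBoundary d j) = 0 := by
  have hsub : gridBoundary d j ⊆ ⋃ (i : Fin d) (m : ℤ),
      {x : Torus d | x i = (((m : ℝ) / 2 ^ j : ℝ) : AddCircle (1 : ℝ))} := by
    rintro x ⟨i, hi⟩
    rw [← coe_circleRep (x i), ← AddCircle.coe_nsmul] at hi
    obtain ⟨m, hm⟩ := (AddCircle.coe_eq_zero_iff (1 : ℝ)).1 hi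
    refine Set.mem_iUnion₂.2 ⟨i, m, ?_⟩
    simp only [zsmul_eq_mul, mul_one, nsmul_eq_mul, Nat.cast_pow, Nat.cast_ofNat] at hm
    rw [Set.mem_ofPred_eq, hm, mul_div_cancel_left₀ _ (by positivity), coe_circleRep]
  refine measure_mono_null hsub ?_
  simp only [measure_iUnion_null_iff]
  intro i m
  have : NullSingletonClass (volume : Measure (AddCircle (1 : ℝ))) := ⟨fun x => by
    rw [← closedBall_zero, AddCircle.volume_closedBall]
    simp⟩
  exact Measure.pi_hyperplane (fun _ => (volume : Measure (AddCircle (1 : ℝ)))) i _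

lemma dist_coe_le (a b : ℝ) : dist (a : AddCircle (1 : ℝ)) b ≤ |a - b| := by
  rw [dist_eq_norm, ← AddCircle.coe_sub]
  exact QuotientAddGroup.norm_mk_le_norm

lemma dist_coe_eq {a b : ℝ} (h : |a - b| ≤ 1 / 2) :
    dist (a : AddCircle (1 : ℝ)) b = |a - b| := by
  rw [dist_eq_norm, ← AddCircle.coe_sub, AddCircle.norm_coe_eq_abs_iff _ one_ne_zero]
  simpa using h

lemma dist_circle_le (u v : AddCircle (1 : ℝ)) : dist u v ≤ 1 / 2 := by
  rw [dist_eq_norm]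
  simpa using AddCircle.norm_le_half_period (1 : ℝ) (x := u - v) one_ne_zero

/-- Points near `↑a` lift to reals near `a`. -/
lemma exists_lift (a : ℝ) (u : AddCircle (1 : ℝ)) :
    ∃ y : ℝ, (y : AddCircle (1 : ℝ)) = u ∧ |y - a| = dist u a := by
  have h : dist u a = ‖((circleRep u - a : ℝ) : AddCircle (1 : ℝ))‖ := by
    rw [AddCircle.coe_sub, coe_circleRep, dist_eq_norm]
  rw [h, AddCircle.norm_eq]
  refine ⟨circleRep u - round (1⁻¹ * (circleRep u - a)) * 1, ?_, ?_⟩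
  · have : (((round (1⁻¹ * (circleRep u - a)) * 1 : ℝ)) : AddCircle (1 : ℝ)) = 0 :=
      (AddCircle.coe_eq_zero_iff (1 : ℝ)).2 ⟨round (1⁻¹ * (circleRep u - a)), by simp⟩
    rw [AddCircle.coe_sub, this, coe_circleRep, sub_zero]
  · congr 1; ring

lemma ball_cellCenter_subset {j : ℕ} {k : Fin d → ℤ} (hk : k ∈ cellIndices d j) :
    ball (cellCenter j k) ((1 / 2) ^ (j + 1)) ⊆ cell j k := by
  intro x hx
  rw [mem_ball, dist_pi_lt_iff (by positivity)] at hx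
  choose y hy hy' using fun i => exists_lift (((k i : ℝ) + 1 / 2) / 2 ^ j) (x i)
  rw [cell_eq_image hk]
  refine ⟨y, fun i _ => ?_, funext hy⟩
  rw [mem_Ico_div_iff, Int.floor_eq_iff]
  have h2 : |y i - ((k i : ℝ) + 1 / 2) / 2 ^ j| < (1 / 2) ^ (j + 1) := (hy' i).trans_lt (hx i)
  rw [pow_succ, one_div_pow, abs_lt] at h2
  have h3 : (0 : ℝ) < 2 ^ j := by positivity
  have e1 : (2 : ℝ) ^ j * (((k i : ℝ) + 1 / 2) / 2 ^ j) = k i + 1 / 2 := by field_simp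
  have e2 : (2 : ℝ) ^ j * (1 / 2 ^ j) = 1 := by field_simp
  constructor <;> nlinarith [mul_lt_mul_of_pos_left h2.1 h3, mul_lt_mul_of_pos_left h2.2 h3]

lemma cell_diff_gridBoundary_subset {j : ℕ} (k : Fin d → ℤ) :
    cell j k \ gridBoundary d j ⊆ ball (cellCenter j k) ((1 / 2) ^ (j + 1)) := by
  rintro x ⟨hx, hx'⟩
  rw [mem_cell] at hx
  rw [mem_ball, dist_pi_lt_iff (by positivity)]
  intro i
  have hi : ⌊(2 : ℝ) ^ j * circleRep (x i)⌋ = k i := congrFun hx i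
  rw [Int.floor_eq_iff] at hi
  have hne : (k i : ℝ) ≠ 2 ^ j * circleRep (x i) := by
    intro h
    refine hx' ⟨i, ?_⟩
    rw [← coe_circleRep (x i), ← AddCircle.coe_nsmul]
    refine (AddCircle.coe_eq_zero_iff (1 : ℝ)).2 ⟨k i, ?_⟩
    simp [h]
  have hlt := lt_of_le_of_ne hi.1 hne
  rw [← coe_circleRep (x i)]
  refine (dist_coe_le _ _).trans_lt ?_
  have h3 : (0 : ℝ) < 2 ^ j := by positivity
  have e : circleRep (x i) - ((k i : ℝ) + 1 / 2) / 2 ^ j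
      = (2 ^ j * circleRep (x i) - k i - 1 / 2) / 2 ^ j := by field_simp; ring
  rw [e, abs_div, abs_of_pos h3, div_lt_iff₀ h3, pow_succ, one_div_pow]
  have e2 : 1 / (2 : ℝ) ^ j * (1 / 2) * 2 ^ j = 1 / 2 := by field_simp
  rw [e2, abs_lt]
  constructor <;> linarith [hi.2]

lemma cell_diff_gridBoundary_subset_interior (j : ℕ) (k : Fin d → ℤ) :
    cell j k \ gridBoundary d j ⊆ interior (cell j k) := by
  intro x hx
  have hk : k ∈ cellIndices d j := by
    rw [← mem_cell.1 hx.1]; exact cellIdx_mem_cellIndices j x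
  exact interior_maximal (ball_cellCenter_subset hk) isOpen_ball
    (cell_diff_gridBoundary_subset k hx)

lemma measure_cell_eq {m : Measure (Torus d)} (hm : m ≪ volume) {j : ℕ} {k : Fin d → ℤ}
    (hk : k ∈ cellIndices d j) :
    m (cell j k) = m (ball (cellCenter j k) ((1 / 2) ^ (j + 1))) := by
  refine le_antisymm ?_ (measure_mono (ball_cellCenter_subset hk))
  calc m (cell j k) ≤ m (cell j k \ gridBoundary d j ∪ gridBoundary d j) :=
        measure_mono (by rw [Set.sdiff_union_self]; exact Set.subset_union_left)
    _ ≤ m (cell j k \ gridBoundary d j) + m (gridBoundary d j) := measure_union_le _ _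
    _ ≤ m (ball (cellCenter j k) ((1 / 2) ^ (j + 1))) + 0 :=
        add_le_add (measure_mono (cell_diff_gridBoundary_subset k))
          (hm (volume_gridBoundary j)).le
    _ = _ := add_zero _

lemma volume_ball_cellCenter (j : ℕ) (z : Torus d) :
    volume (ball z ((1 / 2) ^ (j + 1))) = ENNReal.ofReal (((1 / 2) ^ j) ^ d) := by
  rw [volume_pi_ball _ (by positivity)]
  have h : ∀ i, volume (ball (z i) ((1 / 2 : ℝ) ^ (j + 1))) = ENNReal.ofReal ((1 / 2) ^ j) := by
    intro i
    rw [← measure_congr AddCircle.closedBall_ae_eq_ball, AddCircle.volume_closedBall]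
    congr 1
    rw [pow_succ, min_eq_right]
    · ring
    · have : (1 / 2 : ℝ) ^ j ≤ 1 := pow_le_one₀ (by norm_num) (by norm_num)
      linarith
  simp only [h, Finset.prod_const, Finset.card_univ, Fintype.card_fin]
  rw [← ENNReal.ofReal_pow (by positivity)]

lemma cell_eq_empty {j : ℕ} {k : Fin d → ℤ} (hk : k ∉ cellIndices d j) : cell j k = ∅ := by
  rw [Set.eq_empty_iff_forall_notMem]
  intro x hx
  rw [← mem_cell.1 hx] at hk
  exact hk (cellIdx_mem_cellIndices j x)

lemma cell_nonempty {j : ℕ} {k : Fin d → ℤ} (hk : k ∈ cellIndices d j) : (cell j k).Nonempty := by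
  rw [cell_eq_image hk]
  refine Set.Nonempty.image _ (Set.univ_pi_nonempty_iff.2 fun i => Set.nonempty_Ico.2 ?_)
  gcongr
  linarith

lemma dist_le_of_cellIdx_eq {j : ℕ} {x y : Torus d} (h : cellIdx j x = cellIdx j y) :
    dist x y ≤ (1 / 2) ^ (max j 1) := by
  rw [dist_pi_le_iff (by positivity)]
  intro i
  have key : dist (x i) (y i) ≤ (1 / 2) ^ j := by
    rw [← coe_circleRep (x i), ← coe_circleRep (y i)]
    refine (dist_coe_le _ _).trans ?_
    have := (Int.abs_sub_lt_one_of_floor_eq_floor (congrFun h i)).le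
    rw [← mul_sub, abs_mul, abs_of_pos (by positivity : (0 : ℝ) < 2 ^ j)] at this
    rwa [one_div_pow, le_div_iff₀' (by positivity)]
  rcases le_total j 1 with h1 | h1
  · rw [max_eq_right h1, pow_one]; exact dist_circle_le _ _
  · rwa [max_eq_left h1]

lemma ediam_cell (hd : 0 < d) {j : ℕ} {k : Fin d → ℤ} (hk : k ∈ cellIndices d j) :
    ediam (cell j k) = ENNReal.ofReal ((1 / 2) ^ (max j 1)) := by
  refine le_antisymm (ediam_le fun x hx y hy => ?_) ?_
  · rw [edist_dist]
    exact ENNReal.ofReal_le_ofReal (dist_le_of_cellIdx_eq ((mem_cell.1 hx).trans (mem_cell.1 hy).symm))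
  · refine le_of_forall_lt fun b hb => ?_
    obtain ⟨r, rfl⟩ : ∃ r : NNReal, b = r := ⟨b.toNNReal, by
      rw [ENNReal.coe_toNNReal hb.ne_top]⟩
    rw [← ENNReal.ofReal_coe_nnreal, ENNReal.ofReal_lt_ofReal_iff (by positivity)] at hb
    obtain ⟨δ, hδ, hδ'⟩ := exists_between hb
    have hδ0 : 0 < δ := r.coe_nonneg.trans_lt hδ
    have hδj : δ < (1 / 2) ^ j :=
      hδ'.trans_le (pow_le_pow_of_le_one (by norm_num) (by norm_num) (le_max_left _ _))
    have hδ1 : δ ≤ 1 / 2 := by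
      have := hδ'.le.trans
        (pow_le_pow_of_le_one (by norm_num : (0 : ℝ) ≤ 1 / 2) (by norm_num) (le_max_right j 1))
      simpa using this
    have h3 : (0 : ℝ) < 2 ^ j := by positivity
    have hmem : ∀ ε : ℝ, 0 ≤ ε → ε < (1 / 2) ^ j →
        torusProj (fun i => (k i : ℝ) / 2 ^ j + ε) ∈ cell j k := by
      intro ε h0 h1
      rw [cell_eq_image hk]
      refine ⟨_, fun i _ => ⟨by linarith, ?_⟩, rfl⟩
      rw [add_div]
      rw [one_div_pow] at h1
      linarith
    calc (r : ℝ≥0∞) = ENNReal.ofReal r := (ENNReal.ofReal_coe_nnreal).symm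
      _ < ENNReal.ofReal δ := (ENNReal.ofReal_lt_ofReal_iff hδ0).2 hδ
      _ ≤ edist (torusProj (fun i => (k i : ℝ) / 2 ^ j + δ))
            (torusProj (fun i => (k i : ℝ) / 2 ^ j + 0)) := by
          rw [edist_dist]
          apply ENNReal.ofReal_le_ofReal
          refine le_trans ?_ (dist_le_pi_dist _ _ ⟨0, hd⟩)
          simp only [torusProj]
          rw [dist_coe_eq] <;> rw [add_sub_add_left_eq_sub, sub_zero, abs_of_pos hδ0]
          exact hδ1
      _ ≤ _ := edist_le_ediam_of_mem (hmem δ hδ0.le hδj) (hmem 0 le_rfl (by positivity))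

end Cells

section Redistribution

variable {d : ℕ}

lemma rpow_neg_mul_measure_cell_le {m : Measure (Torus d)} {s : ℝ} (hs : 0 < s) {j : ℕ}
    {k : Fin d → ℤ} {x : Torus d} (hx : x ∈ cell j k) :
    ENNReal.ofReal (((1 / 2 : ℝ) ^ j) ^ (-s)) * m (cell j k) ≤ ∫⁻ y, edist x y ^ (-s) ∂m := by
  have hr : (0 : ℝ) < (1 / 2) ^ j := by positivity
  calc _ = ∫⁻ _ in cell j k, ENNReal.ofReal (((1 / 2 : ℝ) ^ j) ^ (-s)) ∂m := by
        rw [setLIntegral_const]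
    _ ≤ ∫⁻ y in cell j k, edist x y ^ (-s) ∂m := by
        refine setLIntegral_mono' (measurableSet_cell j k) fun y hy => ?_
        rw [← ENNReal.ofReal_rpow_of_pos hr, ENNReal.rpow_neg, ENNReal.rpow_neg]
        refine ENNReal.inv_le_inv.2 (ENNReal.rpow_le_rpow ?_ hs.le)
        rw [edist_dist]
        refine ENNReal.ofReal_le_ofReal
          ((dist_le_of_cellIdx_eq ((mem_cell.1 hx).trans (mem_cell.1 hy).symm)).trans ?_)
        exact pow_le_pow_of_le_one (by norm_num) (by norm_num) (le_max_left _ _)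
    _ ≤ _ := setLIntegral_le_lintegral _ _

lemma exists_measurableSet_low_potential {m : Measure (Torus d)} [IsFiniteMeasure m] {s c M : ℝ}
    (hs : 0 < s) (hM : 0 < M)
    (hm : ∫⁻ x, ∫⁻ y, edist x y ^ (-s) ∂m ∂m < ENNReal.ofReal c) :
    ∃ A : Set (Torus d), MeasurableSet A ∧ m.real Aᶜ ≤ c / M ∧
      ∀ j k, m.real (cell j k ∩ A) ≤ M * ((1 / 2 : ℝ) ^ j) ^ s := by
  have hc : 0 < c := ENNReal.ofReal_pos.1 (bot_lt_of_lt hm)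
  have hmeas : Measurable fun x : Torus d => ∫⁻ y, edist x y ^ (-s) ∂m := by
    apply Measurable.lintegral_prod_right' (f := fun p : Torus d × Torus d => edist p.1 p.2 ^ (-s))
    exact measurable_edist.pow_const _
  refine ⟨{x | ∫⁻ y, edist x y ^ (-s) ∂m < ENNReal.ofReal M},
    measurableSet_lt hmeas measurable_const, ?_, fun j k => ?_⟩
  · have h := (mul_meas_ge_le_lintegral hmeas (ENNReal.ofReal M)).trans hm.le
    rw [← ofReal_measureReal, ← ENNReal.ofReal_mul hM.le,
      ENNReal.ofReal_le_ofReal_iff hc.le] at h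
    rw [le_div_iff₀' hM]
    have hcompl : {x : Torus d | ∫⁻ y, edist x y ^ (-s) ∂m < ENNReal.ofReal M}ᶜ
        = {x | ENNReal.ofReal M ≤ ∫⁻ y, edist x y ^ (-s) ∂m} := by
      ext x
      simp
    rwa [hcompl]
  · by_cases hne : (cell j k ∩ {x | ∫⁻ y, edist x y ^ (-s) ∂m < ENNReal.ofReal M}).Nonempty
    · obtain ⟨x, hx, hxA⟩ := hne
      refine (measureReal_mono Set.inter_subset_left).trans ?_
      have hr : (0 : ℝ) < (1 / 2) ^ j := by positivity
      have h2 := (rpow_neg_mul_measure_cell_le (m := m) hs hx).trans (le_of_lt hxA)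
      rw [← ofReal_measureReal, ← ENNReal.ofReal_mul (by positivity),
        ENNReal.ofReal_le_ofReal_iff hM.le, Real.rpow_neg hr.le, inv_mul_le_iff₀ (by positivity)]
        at h2
      linarith
    · rw [Set.not_nonempty_iff_eq_empty] at hne
      rw [hne, measureReal_empty]
      positivity

/-- `ν` is a finite measure of mass larger than `σ`, carried by the open set `U`, whose mass on
each dyadic cube is at most the `t`-th power of the diameter of the cube, and at most a constant
times the `s`-th power of its side. -/
structure IsFrostmanOn (s t σ : ℝ) (ν : Measure (Torus d)) (U : Set (Torus d)) : Prop where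
  finite : IsFiniteMeasure ν
  isOpen : IsOpen U
  measure_compl : ν Uᶜ = 0
  lt_mass : σ < ν.real Set.univ
  cell_le : ∀ j k, ν.real (cell j k) ≤ ((1 / 2 : ℝ) ^ max j 1) ^ t
  exists_cell_le : ∃ M > 0, ∀ j k, ν.real (cell j k) ≤ M * ((1 / 2 : ℝ) ^ j) ^ s

/-- The indices of the dyadic cubes of side `2^{-q}` whose closure lies in `U`. -/
def innerIndices (q : ℕ) (U : Set (Torus d)) : Finset (Fin d → ℤ) :=
  open Classical in (cellIndices d q).filter fun k => closure (cell q k) ⊆ U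

lemma mem_innerIndices {q : ℕ} {U : Set (Torus d)} {k : Fin d → ℤ} :
    k ∈ innerIndices q U ↔ k ∈ cellIndices d q ∧ closure (cell q k) ⊆ U := by
  simp [innerIndices]

lemma monotone_innerCells (U : Set (Torus d)) :
    Monotone fun q => ⋃ k ∈ innerIndices q U, cell q k := by
  intro q q' h x hx
  obtain ⟨k, hk, hx⟩ := Set.mem_iUnion₂.1 hx
  refine Set.mem_iUnion₂.2 ⟨cellIdx q' x, mem_innerIndices.2 ⟨cellIdx_mem_cellIndices _ _,
    (closure_mono fun y hy => ?_).trans (mem_innerIndices.1 hk).2⟩, mem_cell_cellIdx _ _⟩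
  exact (cellIdx_congr h hy).trans hx

lemma iUnion_innerCells {U : Set (Torus d)} (hU : IsOpen U) :
    ⋃ q, ⋃ k ∈ innerIndices q U, cell q k = U := by
  ext x
  constructor
  · intro hx
    obtain ⟨q, hx⟩ := Set.mem_iUnion.1 hx
    obtain ⟨k, hk, hx⟩ := Set.mem_iUnion₂.1 hx
    exact (mem_innerIndices.1 hk).2 (subset_closure hx)
  · intro hx
    obtain ⟨ε, hε, hb⟩ := Metric.isOpen_iff.1 hU x hx
    obtain ⟨q, hq⟩ := exists_pow_lt_of_lt_one hε (by norm_num : (1 / 2 : ℝ) < 1)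
    refine Set.mem_iUnion.2 ⟨q, Set.mem_iUnion₂.2 ⟨cellIdx q x, mem_innerIndices.2
      ⟨cellIdx_mem_cellIndices _ _, ?_⟩, mem_cell_cellIdx _ _⟩⟩
    refine (closure_minimal (t := closedBall x ((1 / 2) ^ q)) (fun y hy => ?_)
      isClosed_closedBall).trans ((closedBall_subset_ball hq).trans hb)
    exact (dist_le_of_cellIdx_eq hy).trans
      (pow_le_pow_of_le_one (by norm_num) (by norm_num) (le_max_left _ _))

lemma eventually_lt_innerCells {ν : Measure (Torus d)} [IsFiniteMeasure ν] {U : Set (Torus d)}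
    {σ : ℝ} (hU : IsOpen U) (hν : ν Uᶜ = 0) (hσ : σ < ν.real Set.univ) :
    ∀ᶠ q in atTop, σ < ∑ k ∈ innerIndices q U, ν.real (cell q k) := by
  have h1 := tendsto_measure_iUnion_atTop (μ := ν) (monotone_innerCells U)
  rw [iUnion_innerCells hU, measure_of_measure_compl_eq_zero hν] at h1
  have h2 := (ENNReal.tendsto_toReal (measure_ne_top ν Set.univ)).comp h1
  filter_upwards [h2.eventually_const_lt hσ] with q hq
  refine hq.trans_eq ?_
  change ν.real _ = _
  rw [measureReal_biUnion_finset _ fun k _ => measurableSet_cell q k]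
  intro k _ k' _ hkk
  exact Set.disjoint_left.2 fun x hx hx' => hkk (hx.symm.trans hx')

/-- The measure carried by `A` obtained from `m` by giving to each of the dyadic cubes of side
`2^{-q}` with index in `G` its `ν`-mass. -/
def redistribute (ν m : Measure (Torus d)) (A : Set (Torus d)) (q : ℕ) (G : Finset (Fin d → ℤ)) :
    Measure (Torus d) :=
  ∑ k ∈ G, ENNReal.ofReal (ν.real (cell q k) / m.real (cell q k ∩ A)) • m.restrict (cell q k ∩ A)

variable {ν m : Measure (Torus d)} {A : Set (Torus d)} {q : ℕ} {G : Finset (Fin d → ℤ)}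

instance [IsFiniteMeasure m] : IsFiniteMeasure (redistribute ν m A q G) := by
  refine ⟨?_⟩
  rw [redistribute, Measure.finsetSum_apply]
  refine ENNReal.sum_lt_top.2 fun k _ => ?_
  rw [Measure.smul_apply, smul_eq_mul]
  exact ENNReal.mul_lt_top ENNReal.ofReal_lt_top (measure_lt_top _ _)

lemma redistribute_real_apply [IsFiniteMeasure m] {S : Set (Torus d)} (hS : MeasurableSet S) :
    (redistribute ν m A q G).real S
      = ∑ k ∈ G, ν.real (cell q k) / m.real (cell q k ∩ A) * m.real (S ∩ (cell q k ∩ A)) := by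
  rw [measureReal_def, redistribute, Measure.finsetSum_apply, ENNReal.toReal_sum]
  · refine Finset.sum_congr rfl fun k _ => ?_
    rw [Measure.smul_apply, smul_eq_mul, ENNReal.toReal_mul, ENNReal.toReal_ofReal (by positivity),
      Measure.restrict_apply hS, measureReal_def (s := S ∩ _)]
  · intro k _
    rw [Measure.smul_apply, smul_eq_mul]
    exact ENNReal.mul_ne_top ENNReal.ofReal_ne_top (measure_ne_top _ _)

lemma redistribute_real_univ [IsFiniteMeasure m] (hG : ∀ k ∈ G, 0 < m.real (cell q k ∩ A)) :
    (redistribute ν m A q G).real Set.univ = ∑ k ∈ G, ν.real (cell q k) := by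
  rw [redistribute_real_apply MeasurableSet.univ]
  refine Finset.sum_congr rfl fun k hk => ?_
  rw [Set.univ_inter, div_mul_cancel₀ _ (hG k hk).ne']

lemma redistribute_real_cell_le_of_le [IsFiniteMeasure ν] [IsFiniteMeasure m]
    (hG : ∀ k ∈ G, 0 < m.real (cell q k ∩ A)) {j : ℕ} (hj : j ≤ q) (l : Fin d → ℤ) :
    (redistribute ν m A q G).real (cell j l) ≤ ν.real (cell j l) := by
  rw [redistribute_real_apply (measurableSet_cell j l)]
  calc _ ≤ ∑ k ∈ G, ν.real (cell q k ∩ cell j l) := by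
        refine Finset.sum_le_sum fun k hk => ?_
        rcases cell_subset_or_disjoint hj k l with h | h
        · rw [Set.inter_eq_self_of_subset_left h, Set.inter_eq_self_of_subset_right
            (Set.inter_subset_left.trans h), div_mul_cancel₀ _ (hG k hk).ne']
        · have : cell j l ∩ (cell q k ∩ A) = ∅ := by
            rw [← Set.disjoint_iff_inter_eq_empty]
            exact h.symm.mono_right Set.inter_subset_left
          rw [this, measureReal_empty, mul_zero]
          positivity
    _ = ν.real (⋃ k ∈ G, cell q k ∩ cell j l) := by
        rw [measureReal_biUnion_finset _ fun k _ =>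
          (measurableSet_cell q k).inter (measurableSet_cell j l)]
        intro k _ k' _ hkk
        exact Set.disjoint_left.2 fun x hx hx' => hkk (hx.1.symm.trans hx'.1)
    _ ≤ _ := measureReal_mono (Set.iUnion₂_subset fun k _ => Set.inter_subset_right)

lemma redistribute_real_cell_le_of_ge [IsFiniteMeasure m] {w : ℝ} (hw : 0 ≤ w)
    (hG : ∀ k ∈ G, ν.real (cell q k) / m.real (cell q k ∩ A) ≤ w) {j : ℕ} (hj : q ≤ j)
    (l : Fin d → ℤ) :
    (redistribute ν m A q G).real (cell j l) ≤ w * m.real (cell j l ∩ A) := by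
  rw [redistribute_real_apply (measurableSet_cell j l)]
  by_cases hne : (cell j l).Nonempty
  · obtain ⟨x, hx⟩ := hne
    have h0 : ∀ k ∈ G, k ≠ cellIdx q x →
        ν.real (cell q k) / m.real (cell q k ∩ A) * m.real (cell j l ∩ (cell q k ∩ A)) = 0 := by
      intro k _ hk
      have : cell j l ∩ (cell q k ∩ A) = ∅ := by
        rw [Set.eq_empty_iff_forall_notMem]
        rintro y ⟨hy, hy', -⟩
        exact hk (hy'.symm.trans (cellIdx_congr hj (hy.trans hx.symm)))
      rw [this, measureReal_empty, mul_zero]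
    by_cases hmem : cellIdx q x ∈ G
    · rw [Finset.sum_eq_single_of_mem _ hmem h0]
      refine mul_le_mul (hG _ hmem) (measureReal_mono ?_) measureReal_nonneg hw
      exact Set.inter_subset_inter_right _ Set.inter_subset_right
    · rw [Finset.sum_eq_zero fun k hk => h0 k hk (ne_of_mem_of_not_mem hk hmem)]
      positivity
  · rw [Set.not_nonempty_iff_eq_empty] at hne
    simp only [hne, Set.empty_inter, measureReal_empty, mul_zero, Finset.sum_const_zero, le_refl]

end Redistribution

section Construction

variable {d : ℕ}

lemma eventually_mul_rpow_le_one (K : ℝ) {u : ℝ} (hu : 0 < u) :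
    ∀ᶠ q : ℕ in atTop, K * ((1 / 2 : ℝ) ^ q) ^ u ≤ 1 := by
  have h1 : Tendsto (fun q : ℕ => (1 / 2 : ℝ) ^ q) atTop (𝓝 0) :=
    tendsto_pow_atTop_nhds_zero_of_lt_one (by norm_num) (by norm_num)
  have h2 : Tendsto (fun q : ℕ => K * ((1 / 2 : ℝ) ^ q) ^ u) atTop (𝓝 (K * 0 ^ u)) :=
    (h1.rpow_const (Or.inr hu.le)).const_mul K
  rw [Real.zero_rpow hu.ne', mul_zero] at h2
  exact h2.eventually_le_const one_pos

lemma rpow_mul_pow_le {s a b : ℝ} (hsd : s ≤ d) (ha : 0 < a) (hab : a ≤ b) :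
    b ^ s * a ^ d / b ^ d ≤ a ^ s := by
  have hb := ha.trans_le hab
  have h : (a / b) ^ (d : ℝ) ≤ (a / b) ^ s :=
    Real.rpow_le_rpow_of_exponent_ge (by positivity) ((div_le_one hb).2 hab) hsd
  rw [Real.rpow_natCast, div_pow, Real.div_rpow ha.le hb.le, le_div_iff₀ (by positivity)] at h
  calc _ = a ^ d / b ^ d * b ^ s := by ring
    _ ≤ _ := h

/-- The measures `μ n` have `s`-energy less than `c`, and densities on dyadic cubes asymptotically
between `1 / (2c)` and `2c`. -/
structure IsUniformFamily (s c : ℝ) (μ : ℕ → Measure (Torus d)) : Prop where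
  pos : 0 < c
  finite : ∀ n, IsFiniteMeasure (μ n)
  ac : ∀ n, μ n ≪ volume
  energy : ∀ n, ∫⁻ x, ∫⁻ y, edist x y ^ (-s) ∂(μ n) ∂(μ n) < ENNReal.ofReal c
  eventually_cell : ∀ j, ∀ k ∈ cellIndices d j, ∀ᶠ n in atTop,
    ((1 / 2 : ℝ) ^ j) ^ d / (2 * c) ≤ (μ n).real (cell j k) ∧
      (μ n).real (cell j k) ≤ 2 * c * ((1 / 2 : ℝ) ^ j) ^ d

variable {s t σ c : ℝ} {μ : ℕ → Measure (Torus d)} {E : ℕ → Set (Torus d)}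

lemma IsFrostmanOn.exists_refinement (hs : 0 < s) (hts : t < s) (hsd : s ≤ d)
    (hμ : IsUniformFamily s c μ) (hE : ∀ n, IsOpen (E n)) (hμE : ∀ n, μ n (E n)ᶜ = 0)
    {ν : Measure (Torus d)} {U : Set (Torus d)} (h : IsFrostmanOn s t σ ν U) (N : ℕ) :
    ∃ n ≥ N, ∃ (ν' : Measure (Torus d)) (U' : Set (Torus d)), IsFrostmanOn s t σ ν' U' ∧
      closure U' ⊆ U ∧ U' ⊆ E n \ gridBoundary d n := by
  have := h.finite
  have hc := hμ.pos
  obtain ⟨M, hM, hνM⟩ := h.exists_cell_le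
  obtain ⟨q, hqσ, hqM⟩ := ((eventually_lt_innerCells h.isOpen h.measure_compl h.lt_mass).and
    (eventually_mul_rpow_le_one (8 * c ^ 2 * M) (sub_pos.2 hts))).exists
  set R : ℝ := (1 / 2) ^ q with hR
  have hR0 : 0 < R := by positivity
  set M₀ : ℝ := 4 * c ^ 2 / R ^ d with hM₀
  have hM₀0 : 0 < M₀ := by positivity
  set w : ℝ := M * R ^ s / (R ^ d / (4 * c)) with hw
  have hw0 : 0 < w := by positivity
  obtain ⟨p, hp⟩ := (eventually_mul_rpow_le_one (w * M₀) (sub_pos.2 hts)).exists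
  obtain ⟨n, hn, hnN⟩ : ∃ n, (∀ j ∈ Finset.range (p + q + 1), ∀ k ∈ cellIndices d j,
      ((1 / 2 : ℝ) ^ j) ^ d / (2 * c) ≤ (μ n).real (cell j k) ∧
        (μ n).real (cell j k) ≤ 2 * c * ((1 / 2 : ℝ) ^ j) ^ d) ∧ N ≤ n := by
    refine (Eventually.and ?_ (eventually_ge_atTop N)).exists
    simp only [Finset.eventually_all]
    exact fun j _ k hk => hμ.eventually_cell j k hk
  have := hμ.finite n
  obtain ⟨A, hA, hAc, hAcell⟩ := exists_measurableSet_low_potential hs hM₀0 (hμ.energy n)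
  have hAcell' : ∀ j k, (μ n).real (cell j k ∩ A) ≤ M₀ * ((1 / 2 : ℝ) ^ j) ^ s := hAcell
  set G := innerIndices q U with hG
  have hlow : ∀ k ∈ G, R ^ d / (4 * c) ≤ (μ n).real (cell q k ∩ A) := by
    intro k hk
    have h1 := (hn q (Finset.mem_range.2 (by omega)) k (mem_innerIndices.1 hk).1).1
    have h2 : (μ n).real (cell q k) ≤ (μ n).real (cell q k ∩ A) + (μ n).real Aᶜ := by
      refine (measureReal_mono fun x hx => ?_).trans (measureReal_union_le _ _)
      by_cases hxA : x ∈ A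
      · exact Or.inl ⟨hx, hxA⟩
      · exact Or.inr hxA
    have h3 : c / M₀ = R ^ d / (4 * c) := by rw [hM₀]; field_simp
    have h4 : R ^ d / (2 * c) = R ^ d / (4 * c) + R ^ d / (4 * c) := by field_simp; norm_num
    rw [h3] at hAc
    rw [← hR, h4] at h1
    linarith
  have hlow0 : ∀ k ∈ G, 0 < (μ n).real (cell q k ∩ A) :=
    fun k hk => lt_of_lt_of_le (by positivity) (hlow k hk)
  have hratio : ∀ k ∈ G, ν.real (cell q k) / (μ n).real (cell q k ∩ A) ≤ w := fun k hk =>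
    div_le_div₀ (by positivity) (hνM q k) (by positivity) (hlow k hk)
  have hsplit : ∀ r : ℝ, 0 < r → r ^ s = r ^ (s - t) * r ^ t := by
    intro r hr
    rw [← Real.rpow_add hr, sub_add_cancel]
  refine ⟨n, hnN, redistribute ν (μ n) A q G,
    interior (⋃ k ∈ G, cell q k) ∩ (E n \ gridBoundary d n), ⟨inferInstance, ?_, ?_, ?_, ?_, ?_⟩,
    ?_, Set.inter_subset_right⟩
  · exact isOpen_interior.inter ((hE n).sdiff (isClosed_gridBoundary n))
  · rw [redistribute, Measure.finsetSum_apply]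
    refine Finset.sum_eq_zero fun k hk => ?_
    rw [Measure.smul_apply, smul_eq_mul]
    refine mul_eq_zero_of_right _ ?_
    rw [Measure.restrict_apply' ((measurableSet_cell q k).inter hA)]
    refine measure_mono_null (t := (E n)ᶜ ∪ (gridBoundary d n ∪ gridBoundary d q)) ?_ ?_
    · rintro x ⟨hx, hxk, -⟩
      by_contra hcon
      simp only [Set.mem_union, Set.mem_compl_iff, not_or, not_not] at hcon
      refine hx ⟨?_, hcon.1, hcon.2.1⟩
      exact interior_mono (Set.subset_biUnion_of_mem (u := fun k => cell q k) hk)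
        (cell_diff_gridBoundary_subset_interior q k ⟨hxk, hcon.2.2⟩)
    · rw [measure_union_null_iff, measure_union_null_iff]
      exact ⟨hμE n, hμ.ac n (volume_gridBoundary n), hμ.ac n (volume_gridBoundary q)⟩
  · rw [redistribute_real_univ hlow0]
    exact hqσ
  · intro j k
    rcases le_or_gt j q with hj | hj
    · exact (redistribute_real_cell_le_of_le hlow0 hj k).trans (h.cell_le j k)
    · have hr : (0 : ℝ) < (1 / 2) ^ j := by positivity
      rw [max_eq_left (by omega : 1 ≤ j)]
      refine (redistribute_real_cell_le_of_ge hw0.le hratio hj.le k).trans ?_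
      rcases le_or_gt j p with hjp | hjp
      · by_cases hk : k ∈ cellIndices d j
        · have h1 := (hn j (Finset.mem_range.2 (by omega)) k hk).2
          have hrR : (1 / 2 : ℝ) ^ j ≤ R :=
            pow_le_pow_of_le_one (by norm_num) (by norm_num) hj.le
          have h2 := rpow_mul_pow_le hsd hr hrR
          have h3 : ((1 / 2 : ℝ) ^ j) ^ (s - t) ≤ R ^ (s - t) :=
            Real.rpow_le_rpow hr.le hrR (sub_nonneg.2 hts.le)
          set r : ℝ := (1 / 2) ^ j
          calc w * (μ n).real (cell j k ∩ A) ≤ w * (2 * c * r ^ d) := by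
                gcongr
                exact (measureReal_mono Set.inter_subset_left).trans h1
            _ = 8 * c ^ 2 * M * (R ^ s * r ^ d / R ^ d) := by rw [hw]; field_simp; norm_num
            _ ≤ 8 * c ^ 2 * M * r ^ s := by gcongr
            _ = 8 * c ^ 2 * M * r ^ (s - t) * r ^ t := by rw [hsplit r hr]; ring
            _ ≤ 8 * c ^ 2 * M * R ^ (s - t) * r ^ t := by gcongr
            _ ≤ 1 * r ^ t := by gcongr
            _ = r ^ t := one_mul _
        · rw [cell_eq_empty hk, Set.empty_inter, measureReal_empty, mul_zero]
          positivity
      · have h3 : ((1 / 2 : ℝ) ^ j) ^ (s - t) ≤ ((1 / 2 : ℝ) ^ p) ^ (s - t) :=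
          Real.rpow_le_rpow hr.le (pow_le_pow_of_le_one (by norm_num) (by norm_num) hjp.le)
            (sub_nonneg.2 hts.le)
        have h4 := hAcell' j k
        set r : ℝ := (1 / 2) ^ j
        calc w * (μ n).real (cell j k ∩ A) ≤ w * (M₀ * r ^ s) := by gcongr
          _ = w * M₀ * r ^ (s - t) * r ^ t := by rw [hsplit r hr]; ring
          _ ≤ w * M₀ * ((1 / 2 : ℝ) ^ p) ^ (s - t) * r ^ t := by gcongr
          _ ≤ 1 * r ^ t := by gcongr
          _ = r ^ t := one_mul _
  · refine ⟨max M (w * M₀), lt_max_of_lt_left hM, fun j k => ?_⟩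
    rcases le_or_gt j q with hj | hj
    · refine ((redistribute_real_cell_le_of_le hlow0 hj k).trans (hνM j k)).trans ?_
      gcongr
      exact le_max_left _ _
    · refine (redistribute_real_cell_le_of_ge hw0.le hratio hj.le k).trans ?_
      calc w * (μ n).real (cell j k ∩ A) ≤ w * (M₀ * ((1 / 2 : ℝ) ^ j) ^ s) := by
            gcongr
            exact hAcell' j k
        _ = w * M₀ * ((1 / 2 : ℝ) ^ j) ^ s := (mul_assoc _ _ _).symm
        _ ≤ _ := by
            gcongr
            exact le_max_right _ _
  · calc closure (interior (⋃ k ∈ G, cell q k) ∩ (E n \ gridBoundary d n))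
        ⊆ closure (⋃ k ∈ G, cell q k) := closure_mono (Set.inter_subset_left.trans interior_subset)
      _ = ⋃ k ∈ G, closure (cell q k) := Finset.closure_biUnion _ _
      _ ⊆ U := Set.iUnion₂_subset fun k hk => (mem_innerIndices.1 hk).2

lemma volume_cell {j : ℕ} {k : Fin d → ℤ} (hk : k ∈ cellIndices d j) :
    volume (cell j k) = ENNReal.ofReal (((1 / 2) ^ j) ^ d) := by
  rw [measure_cell_eq Measure.AbsolutelyContinuous.rfl hk, volume_ball_cellCenter]

lemma volume_real_cell {j : ℕ} {k : Fin d → ℤ} (hk : k ∈ cellIndices d j) :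
    volume.real (cell j k) = ((1 / 2 : ℝ) ^ j) ^ d := by
  rw [measureReal_def, volume_cell hk, ENNReal.toReal_ofReal (by positivity)]

/-- Normalized Lebesgue measure on a dyadic cube starts the construction. -/
lemma isFrostmanOn_interior_cell (hts : t < s) (hsd : s ≤ d) (ht : 0 < t) {j₀ : ℕ}
    {k₀ : Fin d → ℤ} (hk₀ : k₀ ∈ cellIndices d j₀) (hj₀ : 1 ≤ j₀)
    (hσ : σ < ((1 / 2 : ℝ) ^ j₀) ^ t) :
    IsFrostmanOn s t σ (ENNReal.ofReal (((1 / 2 : ℝ) ^ j₀) ^ t / ((1 / 2 : ℝ) ^ j₀) ^ d) •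
      (volume : Measure (Torus d)).restrict (cell j₀ k₀)) (interior (cell j₀ k₀)) := by
  set R : ℝ := (1 / 2) ^ j₀ with hR
  have hR0 : 0 < R := by positivity
  have hfin : IsFiniteMeasure ((volume : Measure (Torus d)).restrict (cell j₀ k₀)) :=
    ⟨by rw [Measure.restrict_apply_univ, volume_cell hk₀]; exact ENNReal.ofReal_lt_top⟩
  have hreal : ∀ S, (ENNReal.ofReal (R ^ t / R ^ d) •
      (volume : Measure (Torus d)).restrict (cell j₀ k₀)).real S
        = R ^ t / R ^ d * volume.real (S ∩ cell j₀ k₀) := by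
    intro S
    rw [measureReal_ennreal_smul_apply, ENNReal.toReal_ofReal (by positivity),
      measureReal_restrict_apply' (measurableSet_cell _ _)]
  have hle0 : ∀ S : Set (Torus d), volume.real (S ∩ cell j₀ k₀) ≤ R ^ d := by
    intro S
    rw [hR, ← volume_real_cell hk₀]
    exact measureReal_mono Set.inter_subset_right (by rw [volume_cell hk₀]; exact ENNReal.ofReal_ne_top)
  have hle : ∀ j k, volume.real (cell j k ∩ cell j₀ k₀) ≤ ((1 / 2 : ℝ) ^ j) ^ d := by
    intro j k
    by_cases hk : k ∈ cellIndices d j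
    · rw [← volume_real_cell hk]
      exact measureReal_mono Set.inter_subset_left (by rw [volume_cell hk]; exact ENNReal.ofReal_ne_top)
    · rw [cell_eq_empty hk, Set.empty_inter, measureReal_empty]
      positivity
  have htd : t ≤ d := hts.le.trans hsd
  refine ⟨Measure.smul_finite _ ENNReal.ofReal_ne_top, isOpen_interior, ?_, ?_, fun j k => ?_,
    R ^ t / R ^ d, by positivity, fun j k => ?_⟩
  · rw [Measure.smul_apply, smul_eq_mul]
    refine mul_eq_zero_of_right _ ?_
    rw [Measure.restrict_apply' (measurableSet_cell _ _)]
    refine measure_mono_null (t := gridBoundary d j₀) ?_ (volume_gridBoundary j₀)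
    rintro x ⟨hx, hx'⟩
    by_contra hcon
    exact hx (cell_diff_gridBoundary_subset_interior _ _ ⟨hx', hcon⟩)
  · rw [hreal, Set.univ_inter, volume_real_cell hk₀, div_mul_cancel₀ _ (by positivity)]
    exact hσ
  · rw [hreal]
    rcases le_or_gt (max j 1) j₀ with hj | hj
    · calc R ^ t / R ^ d * volume.real (cell j k ∩ cell j₀ k₀) ≤ R ^ t / R ^ d * R ^ d := by
            gcongr
            exact hle0 _
        _ = R ^ t := div_mul_cancel₀ _ (by positivity)
        _ ≤ _ := Real.rpow_le_rpow hR0.le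
            (pow_le_pow_of_le_one (by norm_num) (by norm_num) hj) ht.le
    · have hj1 : max j 1 = j := by omega
      rw [hj1] at hj ⊢
      calc R ^ t / R ^ d * volume.real (cell j k ∩ cell j₀ k₀)
          ≤ R ^ t / R ^ d * ((1 / 2 : ℝ) ^ j) ^ d := by
            gcongr
            exact hle j k
        _ = R ^ t * ((1 / 2 : ℝ) ^ j) ^ d / R ^ d := by ring
        _ ≤ _ := rpow_mul_pow_le htd (by positivity)
            (pow_le_pow_of_le_one (by norm_num) (by norm_num) hj.le)
  · rw [hreal]
    gcongr
    refine (hle j k).trans ?_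
    rw [← Real.rpow_natCast]
    exact Real.rpow_le_rpow_of_exponent_ge (by positivity)
      (pow_le_one₀ (by norm_num) (by norm_num)) hsd

/-- A cover of `limsup E ∩ D` by dyadic cubes, `D` a dyadic cube, has `t`-dimensional size at
least that of `D`. -/
lemma rpow_le_tsum_of_cover (hd : 0 < d) (hts : t < s) (hsd : s ≤ d) (ht : 0 < t)
    (hμ : IsUniformFamily s c μ) (hE : ∀ n, IsOpen (E n)) (hμE : ∀ n, μ n (E n)ᶜ = 0)
    {j₀ : ℕ} {k₀ : Fin d → ℤ} (hk₀ : k₀ ∈ cellIndices d j₀) (hj₀ : 1 ≤ j₀)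
    {f : ℕ → Set (Torus d)} (hf : ∀ n, IsDyadicCube (f n))
    (hcover : (⋂ k, ⋃ j, ⋃ (_ : k ≤ j), E j) ∩ cell j₀ k₀ ⊆ ⋃ n, f n) :
    ENNReal.ofReal ((1 / 2) ^ j₀) ^ t ≤ ∑' n, ediam (f n) ^ t := by
  by_contra! hlt
  rw [ENNReal.ofReal_rpow_of_pos (by positivity)] at hlt
  set σ : ℝ := (∑' n, ediam (f n) ^ t).toReal with hσ
  have hσ' : ∑' n, ediam (f n) ^ t = ENNReal.ofReal σ := (ENNReal.ofReal_toReal hlt.ne_top).symm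
  rw [hσ', ENNReal.ofReal_lt_ofReal_iff (by positivity)] at hlt
  have h0 := isFrostmanOn_interior_cell hts hsd ht hk₀ hj₀ hlt
  let Stage := {p : Measure (Torus d) × Set (Torus d) // IsFrostmanOn s t σ p.1 p.2}
  have hstep : ∀ (N : ℕ) (p : Stage), ∃ p' : Stage, ∃ n ≥ N, closure p'.1.2 ⊆ p.1.2 ∧
      p'.1.2 ⊆ E n \ gridBoundary d n := by
    intro N p
    obtain ⟨n, hn, ν', U', h', hcl, hsub⟩ :=
      p.2.exists_refinement (ht.trans hts) hts hsd hμ hE hμE N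
    exact ⟨⟨(ν', U'), h'⟩, n, hn, hcl, hsub⟩
  choose next hnext using hstep
  let stage : ℕ → Stage := fun i => Nat.rec ⟨(_, _), h0⟩ next i
  let U : ℕ → Set (Torus d) := fun i => (stage i).1.2
  have hU : ∀ i, ∃ n ≥ i, closure (U (i + 1)) ⊆ U i ∧ U (i + 1) ⊆ E n \ gridBoundary d n :=
    fun i => hnext i (stage i)
  have hanti : Antitone fun i => closure (U i) := antitone_nat_of_succ_le fun i => by
    obtain ⟨n, -, hcl, -⟩ := hU i
    exact hcl.trans subset_closure
  obtain ⟨i, hi⟩ : ∃ i, closure (U i) ⊆ ⋃ n, interior (f n) := by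
    refine exists_subset_nhds_of_isCompact hanti.directed_ge
      (fun i => isClosed_closure.isCompact) fun x hx => ?_
    have hxU : ∀ i, x ∈ U i := fun i => by
      obtain ⟨n, -, hcl, -⟩ := hU i
      exact hcl (Set.mem_iInter.1 hx (i + 1))
    have hgrid : ∀ j, x ∉ gridBoundary d j := fun j hj => by
      obtain ⟨n, hn, -, hsub⟩ := hU j
      exact (hsub (hxU (j + 1))).2 (gridBoundary_mono hn hj)
    obtain ⟨n, hn⟩ := Set.mem_iUnion.1 (hcover ⟨Set.mem_iInter.2 fun k => by
      obtain ⟨n, hn, -, hsub⟩ := hU k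
      exact Set.mem_iUnion₂.2 ⟨n, hn, (hsub (hxU (k + 1))).1⟩, interior_subset (hxU 0)⟩)
    obtain ⟨j, k, -, hfn⟩ := isDyadicCube_iff.1 (hf n)
    refine (isOpen_iUnion fun n => isOpen_interior).mem_nhds (Set.mem_iUnion.2 ⟨n, ?_⟩)
    rw [hfn] at hn ⊢
    exact cell_diff_gridBoundary_subset_interior j k ⟨hn, hgrid j⟩
  have hst := (stage i).2
  have := hst.finite
  set ν := (stage i).1.1
  have hcell : ∀ n, ν (f n) ≤ ediam (f n) ^ t := fun n => by
    obtain ⟨j, k, hk, hfn⟩ := isDyadicCube_iff.1 (hf n)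
    rw [hfn, ediam_cell hd hk, ENNReal.ofReal_rpow_of_pos (by positivity), ← ofReal_measureReal]
    exact ENNReal.ofReal_le_ofReal (hst.cell_le j k)
  have hmass : ν Set.univ ≤ ENNReal.ofReal σ :=
    calc ν Set.univ = ν (U i) := (measure_of_measure_compl_eq_zero hst.measure_compl).symm
      _ ≤ ν (⋃ n, f n) := measure_mono
          ((subset_closure.trans hi).trans (Set.iUnion_mono fun n => interior_subset))
      _ ≤ ∑' n, ν (f n) := measure_iUnion_le _
      _ ≤ ∑' n, ediam (f n) ^ t := ENNReal.tsum_le_tsum hcell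
      _ = _ := hσ'
  exact absurd hst.lt_mass (not_lt.2 (ENNReal.toReal_le_of_le_ofReal ENNReal.toReal_nonneg hmass))

end Construction

section Conclusion

variable {d : ℕ}

lemma isUniformFamily {s : ℝ} {μ : ℕ → Measure (Torus d)} (hfin : ∀ n, IsFiniteMeasure (μ n))
    (hac : ∀ n, μ n ≪ (volume : Measure (Torus d)))
    {C : ℝ≥0∞} (hC0 : 0 < C) (hCtop : C < ⊤)
    (hlow : ∀ (z : Torus d) (ρ : ℝ), 0 < ρ →
      C⁻¹ ≤ liminf (fun n => μ n (ball z ρ) / volume (ball z ρ)) atTop)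
    (hhigh : ∀ (z : Torus d) (ρ : ℝ), 0 < ρ →
      limsup (fun n => μ n (ball z ρ) / volume (ball z ρ)) atTop ≤ C)
    (henergy : ∀ n, (∫⁻ x, ∫⁻ y, edist x y ^ (-s) ∂(μ n) ∂(μ n)) < C) :
    IsUniformFamily s C.toReal μ := by
  have hc : 0 < C.toReal := ENNReal.toReal_pos hC0.ne' hCtop.ne
  have hC : C = ENNReal.ofReal C.toReal := (ENNReal.ofReal_toReal hCtop.ne).symm
  refine ⟨hc, hfin, hac, fun n => hC ▸ henergy n, fun j k hk => ?_⟩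
  have hρ : (0 : ℝ) < (1 / 2) ^ (j + 1) := by positivity
  have h1 : ENNReal.ofReal ((2 * C.toReal)⁻¹) < C⁻¹ := by
    conv_rhs => rw [hC]
    rw [← ENNReal.ofReal_inv_of_pos hc, ENNReal.ofReal_lt_ofReal_iff (by positivity)]
    exact inv_strictAnti₀ hc (by linarith)
  have h2 : C < ENNReal.ofReal (2 * C.toReal) := by
    conv_lhs => rw [hC]
    rw [ENNReal.ofReal_lt_ofReal_iff (by positivity)]
    linarith
  filter_upwards [eventually_lt_of_lt_liminf (h1.trans_le (hlow (cellCenter j k) _ hρ)),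
    eventually_lt_of_limsup_lt ((hhigh (cellCenter j k) _ hρ).trans_lt h2)] with n hn1 hn2
  have := hfin n
  have hv : (0 : ℝ) < ((1 / 2) ^ j) ^ d := by positivity
  rw [volume_ball_cellCenter, ← measure_cell_eq (hac n) hk, ← ofReal_measureReal,
    ← ENNReal.ofReal_div_of_pos hv] at hn1 hn2
  rw [ENNReal.ofReal_lt_ofReal_iff_of_nonneg (by positivity), lt_div_iff₀ hv] at hn1
  rw [ENNReal.ofReal_lt_ofReal_iff (by positivity), div_lt_iff₀ hv] at hn2
  exact ⟨by rw [div_eq_inv_mul]; exact hn1.le, hn2.le⟩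

lemma IsUniformFamily.le_dim {s c : ℝ} {μ : ℕ → Measure (Torus d)} (hμ : IsUniformFamily s c μ)
    (hs : 0 < s) : s ≤ d := by
  by_contra! hlt
  have hc := hμ.pos
  obtain ⟨q, hq⟩ := (eventually_mul_rpow_le_one (4 * c ^ 3) (sub_pos.2 hlt)).exists
  have h0 : (0 : Fin d → ℤ) ∈ cellIndices d 0 := by
    rw [cellIndices, Fintype.mem_piFinset]
    simp
  obtain ⟨n, hnq, hn0⟩ : ∃ n, (∀ k ∈ cellIndices d q,
      ((1 / 2 : ℝ) ^ q) ^ d / (2 * c) ≤ (μ n).real (cell q k)) ∧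
        1 / (2 * c) ≤ (μ n).real Set.univ := by
    refine (Eventually.and (f := atTop) ?_ ?_).exists
    · simp only [Finset.eventually_all]
      exact fun k hk => (hμ.eventually_cell q k hk).mono fun n h => h.1
    · filter_upwards [hμ.eventually_cell 0 0 h0] with n hn
      have := hμ.finite n
      simpa using hn.1.trans (measureReal_mono (Set.subset_univ _))
  have := hμ.finite n
  set r : ℝ := (1 / 2) ^ q with hr
  have hr0 : 0 < r := by positivity
  have hpot : ∀ x, ENNReal.ofReal (r ^ (-s) * (r ^ d / (2 * c)))
      ≤ ∫⁻ y, edist x y ^ (-s) ∂(μ n) := by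
    intro x
    refine le_trans ?_ (rpow_neg_mul_measure_cell_le hs (mem_cell_cellIdx q x))
    rw [ENNReal.ofReal_mul (by positivity), ← ofReal_measureReal]
    gcongr
    exact hnq _ (cellIdx_mem_cellIndices q x)
  have henergy : ENNReal.ofReal (r ^ (-s) * (r ^ d / (2 * c)) * (1 / (2 * c)))
      < ENNReal.ofReal c := by
    refine lt_of_le_of_lt ?_ (hμ.energy n)
    calc _ ≤ ENNReal.ofReal (r ^ (-s) * (r ^ d / (2 * c))) * μ n Set.univ := by
          rw [ENNReal.ofReal_mul (by positivity), ← ofReal_measureReal (s := Set.univ)]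
          gcongr
      _ = ∫⁻ _, ENNReal.ofReal (r ^ (-s) * (r ^ d / (2 * c))) ∂(μ n) := (lintegral_const _).symm
      _ ≤ _ := lintegral_mono hpot
  rw [ENNReal.ofReal_lt_ofReal_iff hc] at henergy
  have hsplit : r ^ (s - d) * (r ^ (-s) * r ^ d) = 1 := by
    rw [← Real.rpow_natCast, ← Real.rpow_add hr0, ← Real.rpow_add hr0]
    simp
  have h1 : r ^ (-s) * r ^ d < 4 * c ^ 3 := by
    calc r ^ (-s) * r ^ d = r ^ (-s) * (r ^ d / (2 * c)) * (1 / (2 * c)) * (4 * c ^ 2) := by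
          field_simp; norm_num
      _ < c * (4 * c ^ 2) := by gcongr
      _ = _ := by ring
  have h2 := mul_lt_mul_of_pos_left h1 (Real.rpow_pos_of_pos hr0 (s - d))
  rw [hsplit] at h2
  linarith

lemma dyadicContent_mono {t : ℝ} {A B : Set (Torus d)} (h : A ⊆ B) :
    dyadicContent t A ≤ dyadicContent t B :=
  iInf_mono fun _ => iInf_mono fun _ => iInf_mono' fun hB => ⟨h.trans hB, le_rfl⟩

lemma exists_cellIdx_eq_of_edist_le {j : ℕ} {x x₀ : Torus d}
    (h : edist x x₀ ≤ ENNReal.ofReal ((1 / 2) ^ j)) :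
    ∃ e : Fin d → Fin 3, cellIdx j x = fun i => (cellIdx j x₀ i + (e i : ℕ) - 1) % 2 ^ j := by
  rw [edist_dist, ENNReal.ofReal_le_ofReal_iff (by positivity), dist_pi_le_iff (by positivity)] at h
  choose y hy hy' using fun i => exists_lift (circleRep (x₀ i)) (x i)
  have h3 : (0 : ℝ) < 2 ^ j := by positivity
  have hfloor : ∀ i, cellIdx j x₀ i - 1 ≤ ⌊(2 : ℝ) ^ j * y i⌋ ∧
      ⌊(2 : ℝ) ^ j * y i⌋ ≤ cellIdx j x₀ i + 1 := by
    intro i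
    have h1 : |y i - circleRep (x₀ i)| ≤ 1 / 2 ^ j := by
      rw [hy', coe_circleRep, ← one_div_pow]
      exact h i
    have h2 : |(2 : ℝ) ^ j * (y i - circleRep (x₀ i))| ≤ 1 := by
      rw [abs_mul, abs_of_pos h3]
      rwa [le_div_iff₀' h3] at h1
    rw [mul_sub, abs_le] at h2
    simp only [cellIdx]
    rw [← Int.floor_sub_one, ← Int.floor_add_one]
    exact ⟨Int.floor_le_floor (by linarith), Int.floor_le_floor (by linarith)⟩
  refine ⟨fun i => ⟨(⌊(2 : ℝ) ^ j * y i⌋ - cellIdx j x₀ i + 1).toNat, ?_⟩, ?_⟩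
  · have := hfloor i
    omega
  · ext i
    rw [← show torusProj y = x from funext hy, cellIdx_torusProj]
    congr 1
    have := hfloor i
    dsimp only
    omega

lemma exists_dyadic_scale {t : ℝ} (ht : 0 < t) {D : ℝ≥0∞} (hD : D ≤ 1) {δ : ℝ≥0∞} (hδ : 0 < δ) :
    ∃ j : ℕ, D ≤ ENNReal.ofReal ((1 / 2) ^ j) ∧
      ENNReal.ofReal ((1 / 2) ^ j) ^ t ≤ 2 ^ t * D ^ t + δ := by
  rcases eq_or_ne D 0 with rfl | hD0
  · have h1 : Tendsto (fun j : ℕ => ENNReal.ofReal ((1 / 2) ^ j) ^ t) atTop (𝓝 0) := by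
      have := (ENNReal.continuous_rpow_const (y := t)).continuousAt.tendsto.comp
        (ENNReal.tendsto_ofReal (tendsto_pow_atTop_nhds_zero_of_lt_one
          (by norm_num : (0 : ℝ) ≤ 1 / 2) (by norm_num)))
      simpa [Function.comp_def, ENNReal.zero_rpow_of_pos ht] using this
    obtain ⟨j, hj⟩ := (h1.eventually_le_const hδ).exists
    exact ⟨j, zero_le, hj.trans le_add_self⟩
  · have hDt : D ≠ ⊤ := (hD.trans_lt ENNReal.one_lt_top).ne
    obtain ⟨x, rfl⟩ : ∃ x : ℝ, D = ENNReal.ofReal x := ⟨_, (ENNReal.ofReal_toReal hDt).symm⟩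
    have hx : 0 < x := ENNReal.ofReal_pos.1 (pos_iff_ne_zero.2 hD0)
    obtain ⟨j, hj1, hj2⟩ := exists_nat_pow_near_of_lt_one hx (ENNReal.ofReal_le_one.1 hD)
      (by norm_num : (0 : ℝ) < 1 / 2) (by norm_num)
    refine ⟨j, ENNReal.ofReal_le_ofReal hj2, le_trans ?_ le_self_add⟩
    rw [← ENNReal.mul_rpow_of_nonneg _ _ ht.le]
    refine ENNReal.rpow_le_rpow ?_ ht.le
    rw [← ENNReal.ofReal_ofNat 2, ← ENNReal.ofReal_mul (by norm_num)]
    refine ENNReal.ofReal_le_ofReal ?_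
    rw [pow_succ] at hj1
    linarith

lemma dyadicContent_eq_zero_of_hausdorffMeasure_eq_zero {t : ℝ} (ht : 0 < t)
    {A : Set (Torus d)} (hA : μH[t] A = 0) : dyadicContent t A = 0 := by
  have key : ∀ ε : ℝ≥0∞, 0 < ε → dyadicContent t A ≤ 3 ^ d * (2 ^ t + 1) * ε := by
    intro ε hε
    rw [Measure.hausdorffMeasure_apply] at hA
    have h1 := le_antisymm ((le_iSup₂ (f := fun (r : ℝ≥0∞) (_ : 0 < r) =>
      ⨅ (S : ℕ → Set (Torus d)) (_ : A ⊆ ⋃ n, S n) (_ : ∀ n, ediam (S n) ≤ r),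
        ∑' n, ⨆ (_ : (S n).Nonempty), ediam (S n) ^ t) 1 one_pos).trans hA.le) zero_le
    have h2 := h1.trans_lt hε
    simp only [iInf_lt_iff] at h2
    obtain ⟨S, hAS, hS1, hSε⟩ := h2
    have hS : ∑' n, ediam (S n) ^ t ≤ ε := by
      refine le_trans (ENNReal.tsum_le_tsum fun n => ?_) hSε.le
      rcases (S n).eq_empty_or_nonempty with h | h
      · simp [h, ENNReal.zero_rpow_of_pos ht]
      · simp [h]
    obtain ⟨δ, hδ, hδε⟩ := ENNReal.exists_pos_sum_of_countable' hε.ne' ℕ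
    choose j hj hjt using fun n => exists_dyadic_scale ht (hS1 n) (hδ n)
    have hbase : ∀ n, ∃ a : Fin d → ℤ, ∀ x ∈ S n, ∃ e : Fin d → Fin 3,
        x ∈ cell (j n) fun i => (a i + (e i : ℕ) - 1) % 2 ^ j n := by
      intro n
      rcases (S n).eq_empty_or_nonempty with h | ⟨x₀, hx₀⟩
      · exact ⟨0, by simp [h]⟩
      · exact ⟨cellIdx (j n) x₀, fun x hx =>
          exists_cellIdx_eq_of_edist_le ((edist_le_ediam_of_mem hx hx₀).trans (hj n))⟩
    choose a ha using hbase
    obtain ⟨φ⟩ := nonempty_equiv_of_countable (α := ℕ) (β := ℕ × (Fin d → Fin 3))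
    let F : ℕ × (Fin d → Fin 3) → Set (Torus d) := fun p =>
      cell (j p.1) fun i => (a p.1 i + (p.2 i : ℕ) - 1) % 2 ^ j p.1
    have hF : ∀ p, IsDyadicCube (F p) := fun p =>
      ⟨j p.1, fun i => a p.1 i + (p.2 i : ℕ) - 1, (torusProj_image_eq_cell _ _).symm⟩
    have hFdiam : ∀ p, ediam (F p) ≤ ENNReal.ofReal ((1 / 2) ^ j p.1) := fun p => by
      refine ediam_le fun x hx y hy => ?_
      rw [edist_dist]
      refine ENNReal.ofReal_le_ofReal
        ((dist_le_of_cellIdx_eq ((mem_cell.1 hx).trans (mem_cell.1 hy).symm)).trans ?_)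
      exact pow_le_pow_of_le_one (by norm_num) (by norm_num) (le_max_left _ _)
    have hcover : A ⊆ ⋃ n, F (φ n) := fun x hx => by
      obtain ⟨n, hn⟩ := Set.mem_iUnion.1 (hAS hx)
      obtain ⟨e, he⟩ := ha n x hn
      refine Set.mem_iUnion.2 ⟨φ.symm (n, e), ?_⟩
      rw [φ.apply_symm_apply]
      exact he
    calc dyadicContent t A ≤ ∑' n, ediam (F (φ n)) ^ t :=
          iInf_le_of_le (fun n => F (φ n)) (iInf₂_le (fun n => hF (φ n)) hcover)
      _ = ∑' p, ediam (F p) ^ t := φ.tsum_eq fun p => ediam (F p) ^ t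
      _ ≤ ∑' p : ℕ × (Fin d → Fin 3), (2 ^ t * ediam (S p.1) ^ t + δ p.1) :=
          ENNReal.tsum_le_tsum fun p =>
            (ENNReal.rpow_le_rpow (hFdiam p) ht.le).trans (hjt p.1)
      _ = ∑' n, 3 ^ d * (2 ^ t * ediam (S n) ^ t + δ n) := by
          rw [ENNReal.tsum_prod']
          simp [tsum_fintype, mul_add]
      _ = 3 ^ d * (2 ^ t * ∑' n, ediam (S n) ^ t + ∑' n, δ n) := by
          rw [ENNReal.tsum_mul_left, ENNReal.tsum_add, ENNReal.tsum_mul_left]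
      _ ≤ 3 ^ d * (2 ^ t * ε + ε) := by gcongr
      _ = _ := by ring
  have hK : (3 ^ d * (2 ^ t + 1) : ℝ≥0∞) ≠ ⊤ := by finiteness
  have hlim : Tendsto (fun n : ℕ => (3 ^ d * (2 ^ t + 1) : ℝ≥0∞) * (n : ℝ≥0∞)⁻¹) atTop (𝓝 0) := by
    have := ENNReal.Tendsto.const_mul ENNReal.tendsto_inv_nat_nhds_zero (Or.inr hK)
    rwa [mul_zero] at this
  exact le_antisymm (ge_of_tendsto' hlim fun n => key _ (by simp)) zero_le

lemma tsum_rpow_ediam_eq_top (hd : 0 < d) {t : ℝ} (ht : t ≤ 0) {f : ℕ → Set (Torus d)}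
    (hf : ∀ n, IsDyadicCube (f n)) : ∑' n, ediam (f n) ^ t = ⊤ := by
  refine top_le_iff.1 ?_
  rw [← ENNReal.tsum_const_eq_top_of_ne_zero (α := ℕ) one_ne_zero]
  refine ENNReal.tsum_le_tsum fun n => ?_
  obtain ⟨j, k, hk, hfn⟩ := isDyadicCube_iff.1 (hf n)
  rw [hfn, ediam_cell hd hk, ENNReal.ofReal_rpow_of_pos (by positivity), ENNReal.one_le_ofReal]
  exact Real.one_le_rpow_of_pos_of_le_one_of_nonpos (by positivity)
    (pow_le_one₀ (by norm_num) (by norm_num)) ht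

end Conclusion

/-- **Lemma 1 (Frostman-type lemma).** If the measures `μ_n` live on the open sets `E_n`,
are absolutely continuous w.r.t. Lebesgue measure, have density ratios on balls
asymptotically bounded between `C⁻¹` and `C`, and have `s`-energies uniformly bounded
by `C`, then `limsup E_n ∈ 𝒢^s(𝕋^d)`; in particular `dim_H (limsup E_n) ≥ s`. -/
theorem frostman_lemma
    (d : ℕ) (hd : 0 < d) (s : ℝ)
    (E : ℕ → Set (Torus d)) (hEopen : ∀ n, IsOpen (E n))
    (μ : ℕ → Measure (Torus d)) (hfin : ∀ n, IsFiniteMeasure (μ n))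
    (hsupp : ∀ n, μ n (E n)ᶜ = 0)
    (hac : ∀ n, μ n ≪ (volume : Measure (Torus d)))
    (C : ℝ≥0∞) (hC0 : 0 < C) (hCtop : C < ⊤)
    (hlow : ∀ (z : Torus d) (ρ : ℝ), 0 < ρ →
      C⁻¹ ≤ liminf (fun n => μ n (ball z ρ) / volume (ball z ρ)) atTop)
    (hhigh : ∀ (z : Torus d) (ρ : ℝ), 0 < ρ →
      limsup (fun n => μ n (ball z ρ) / volume (ball z ρ)) atTop ≤ C)
    (henergy : ∀ n, (∫⁻ x, ∫⁻ y, edist x y ^ (-s) ∂(μ n) ∂(μ n)) < C) :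
    MemLargeIntersectionClass s (⋂ k, ⋃ j, ⋃ (_ : k ≤ j), E j) ∧
      ENNReal.ofReal s ≤ dimH (⋂ k, ⋃ j, ⋃ (_ : k ≤ j), E j) := by
  have hμ := isUniformFamily hfin hac hC0 hCtop hlow hhigh henergy
  have hlarge : MemLargeIntersectionClass s (⋂ k, ⋃ j, ⋃ (_ : k ≤ j), E j) := by
    refine ⟨IsGδ.iInter_of_isOpen fun k => isOpen_iUnion fun j => isOpen_iUnion fun _ => hEopen j,
      fun D hD t hts => le_iInf fun f => le_iInf fun hf => le_iInf fun hcover => ?_⟩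
    rcases le_or_gt t 0 with ht | ht
    · exact le_top.trans_eq (tsum_rpow_ediam_eq_top hd ht hf).symm
    · obtain ⟨j, k, hk, rfl⟩ := isDyadicCube_iff.1 hD
      obtain ⟨x, hx⟩ := cell_nonempty hk
      have hsub : cell (max j 1) (cellIdx (max j 1) x) ⊆ cell j k := fun y hy =>
        (cellIdx_congr (le_max_left j 1) hy).trans hx
      refine le_trans (le_of_eq (congrArg (· ^ t) (ediam_cell hd hk))) ?_
      exact rpow_le_tsum_of_cover hd hts (hμ.le_dim (ht.trans hts)) ht hμ hEopen hsupp
        (cellIdx_mem_cellIndices _ x) (le_max_right j 1) hf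
        ((Set.inter_subset_inter_right _ hsub).trans hcover)
  refine ⟨hlarge, ?_⟩
  by_contra! hlt
  obtain ⟨t, ht, hts⟩ := ENNReal.lt_iff_exists_nnreal_btwn.1 hlt
  have ht0 : (0 : ℝ) < t := NNReal.coe_pos.2 (ENNReal.coe_pos.1 (bot_lt_of_lt ht))
  have hts' : (t : ℝ) < s := by
    rw [← ENNReal.ofReal_coe_nnreal] at hts
    exact (ENNReal.ofReal_lt_ofReal_iff_of_nonneg t.coe_nonneg).1 hts
  have hzero := dyadicContent_eq_zero_of_hausdorffMeasure_eq_zero ht0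
    (hausdorffMeasure_of_dimH_lt ht)
  have hle := (hlarge.2 _ (isDyadicCube_cell 0 0) t hts').trans
    ((dyadicContent_mono Set.inter_subset_left).trans hzero.le)
  change ediam _ ^ (t : ℝ) ≤ 0 at hle
  rw [ediam_cell hd (cellIdx_mem_cellIndices 0 0), ENNReal.ofReal_rpow_of_pos (by positivity),
    ← ENNReal.ofReal_zero, ENNReal.ofReal_le_ofReal_iff le_rfl] at hle
  exact absurd hle (not_le.2 (by positivity))
end
end

section
/- Let (x_j)_{j=1}^∞ be points in 𝕋^d and (r_j)_{j=1}^∞ positive radii with r_j → 0, and suppose that the set E = limsup_{j→∞} B(x_j,r_j) has full Lebesgue measure. Then for any 0 ≤ s ≤ d, the set E_U = limsup_{j→∞} B(x_j, r_j^{d/s}) satisfies dim_H E_U ≥ s. -/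
open MeasureTheory Metric Filter Set
open scoped ENNReal Topology

noncomputable section

section BallCovers

variable {X : Type*} [MetricSpace X]

/-- The total mass `∑ R i ^ t` over those balls `ball (a i) (R i)` whose centre is at distance less
than `ρ + R i` from `y`, hence over all those which meet `closedBall y ρ`. -/
def hitMass (a : ℕ → X) (R : ℕ → ℝ) (t : ℝ) (y : X) (ρ : ℝ) : ℝ≥0∞ :=
  ∑' i : {i | dist y (a i) < ρ + R i}, ENNReal.ofReal (R i ^ t)

variable {a : ℕ → X} {R : ℕ → ℝ} {t : ℝ}

/-- A ball meeting `closedBall y ρ` has radius controlled by the hit mass. -/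
lemma radius_le_of_hitMass_le (hR : ∀ i, 0 < R i) (ht : 0 < t) {y : X} {ρ c : ℝ} (hc : 0 ≤ c)
    (h : hitMass a R t y ρ ≤ ENNReal.ofReal (c ^ t)) {i : ℕ} (hi : dist y (a i) < ρ + R i) :
    R i ≤ c := by
  have h1 : ENNReal.ofReal (R i ^ t) ≤ hitMass a R t y ρ :=
    ENNReal.le_tsum (f := fun i : {i | dist y (a i) < ρ + R i} => ENNReal.ofReal (R i ^ t)) ⟨i, hi⟩
  have h2 := (ENNReal.ofReal_le_ofReal_iff (Real.rpow_nonneg hc t)).1 (h1.trans h)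
  exact (Real.rpow_le_rpow_iff (hR i).le hc ht).1 h2

/-- Concentric sub-balls of disjoint balls which are hit only by small balls of the cover are hit
by different balls of the cover. -/
lemma tsum_hitMass_le {x : ℕ → X} {r w : ℕ → ℝ} {y : X} {ρ : ℝ} {S : Set ℕ}
    (hdisj : S.PairwiseDisjoint fun j => closedBall (x j) (r j))
    (hsub : ∀ j ∈ S, dist (x j) y + r j ≤ ρ) (hw : ∀ j ∈ S, 2 * w j ≤ r j)
    (hsmall : ∀ j ∈ S, ∀ i, dist (x j) (a i) < w j + R i → 4 * R i < r j) :
    ∑' j : S, hitMass a R t (x j) (w j) ≤ hitMass a R t y ρ := by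
  have hd : S.PairwiseDisjoint fun j => {i | dist (x j) (a i) < w j + R i} := by
    intro j hj k hk hjk
    refine Set.disjoint_left.2 fun i hij hik => Set.disjoint_left.1 (hdisj hj hk hjk)
      (?_ : a i ∈ closedBall (x j) (r j)) ?_
    · have := hsmall j hj i hij
      have := hw j hj
      simp only [mem_ofPred_eq] at hij
      rw [mem_closedBall, dist_comm]
      linarith [dist_nonneg (x := x j) (y := a i)]
    · have := hsmall k hk i hik
      have := hw k hk
      simp only [mem_ofPred_eq] at hik
      rw [mem_closedBall, dist_comm]
      linarith [dist_nonneg (x := x k) (y := a i)]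
  unfold hitMass
  rw [← ENNReal.tsum_biUnion' (f := fun i => ENNReal.ofReal (R i ^ t)) hd]
  refine ENNReal.tsum_mono_subtype (fun i => ENNReal.ofReal (R i ^ t)) ?_
  refine iUnion₂_subset fun j hj i hij => ?_
  have h1 := hsub j hj
  have h2 := hw j hj
  simp only [mem_ofPred_eq] at hij ⊢
  have h3 := dist_triangle y (x j) (a i)
  rw [dist_comm y (x j)] at h3
  have h4 := hsmall j hj i hij
  linarith [dist_nonneg (x := x j) (y := a i)]

variable [MeasurableSpace X] {μ : Measure X} {d : ℕ}

/-- If the limsup of the balls `ball (x j) (r j)` has full measure, then any ball contains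
disjoint balls of this family, of arbitrarily large index, whose total volume is comparable. -/
lemma exists_disjoint_subfamily_tsum_ge
    (hlow : ∀ (z : X) (δ : ℝ), 0 ≤ δ → δ ≤ 1 → ENNReal.ofReal (δ ^ d) ≤ μ (closedBall z δ))
    (hup : ∀ (z : X) (δ : ℝ), 0 ≤ δ → μ (closedBall z δ) ≤ ENNReal.ofReal ((2 * δ) ^ d))
    {x : ℕ → X} {r : ℕ → ℝ} (hr : ∀ j, 0 < r j)
    (hfull : μ ((⋂ k, ⋃ j, ⋃ (_ : k ≤ j), ball (x j) (r j))ᶜ) = 0)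
    (y : X) {ρ : ℝ} (hρ : 0 < ρ) (hρ1 : ρ ≤ 1) {N : ℕ} (hN : ∀ j, N ≤ j → 4 * r j ≤ ρ) :
    ∃ S : Set ℕ, (∀ j ∈ S, N ≤ j) ∧ (∀ j ∈ S, dist (x j) y + r j ≤ ρ) ∧
      (S.PairwiseDisjoint fun j => closedBall (x j) (r j)) ∧
      ENNReal.ofReal ((ρ / 20) ^ d) ≤ ∑' j : S, ENNReal.ofReal (r j ^ d) := by
  obtain ⟨S, hSJ, hdisj, hcov⟩ := Vitali.exists_disjoint_subfamily_covering_enlargement_closedBall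
    {j | N ≤ j ∧ dist (x j) y + r j ≤ ρ} x r ρ
    (fun j hj => by linarith [hj.2, dist_nonneg (x := x j) (y := y)]) 5 (by norm_num)
  refine ⟨S, fun j hj => (hSJ hj).1, fun j hj => (hSJ hj).2, hdisj, ?_⟩
  have hsub : closedBall y (ρ / 2) ⊆ (⋂ k, ⋃ j, ⋃ (_ : k ≤ j), ball (x j) (r j))ᶜ ∪
      ⋃ j ∈ S, closedBall (x j) (5 * r j) := by
    intro z hz
    by_cases hzE : z ∈ ⋂ k, ⋃ j, ⋃ (_ : k ≤ j), ball (x j) (r j)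
    · right
      obtain ⟨j, hj, hzj⟩ : ∃ j, N ≤ j ∧ z ∈ ball (x j) (r j) := by
        simpa using mem_iInter.1 hzE N
      have h1 := hN j hj
      rw [mem_closedBall] at hz
      rw [mem_ball] at hzj
      have h2 := dist_triangle (x j) z y
      rw [dist_comm (x j) z] at h2
      obtain ⟨b, hb, hjb⟩ := hcov j ⟨hj, by linarith⟩
      exact mem_biUnion hb (hjb (mem_closedBall.2 hzj.le))
    · exact Or.inl hzE
  have hmeas : ENNReal.ofReal ((ρ / 2) ^ d) ≤
      ENNReal.ofReal (10 ^ d) * ∑' j : S, ENNReal.ofReal (r j ^ d) := calc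
    ENNReal.ofReal ((ρ / 2) ^ d) ≤ μ (closedBall y (ρ / 2)) :=
        hlow _ _ (by linarith) (by linarith)
    _ ≤ 0 + μ (⋃ j ∈ S, closedBall (x j) (5 * r j)) := by
        rw [← hfull]
        exact (measure_mono hsub).trans (measure_union_le _ _)
    _ ≤ ∑' j : S, μ (closedBall (x j) (5 * r j)) := by
        rw [zero_add]
        exact measure_biUnion_le μ S.to_countable _
    _ ≤ ∑' j : S, ENNReal.ofReal (10 ^ d) * ENNReal.ofReal (r j ^ d) := by
        refine ENNReal.tsum_le_tsum fun j => (hup _ _ (by linarith [hr j])).trans_eq ?_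
        rw [← ENNReal.ofReal_mul (by positivity), ← mul_pow]
        ring_nf
    _ = ENNReal.ofReal (10 ^ d) * ∑' j : S, ENNReal.ofReal (r j ^ d) := ENNReal.tsum_mul_left
  have h10 : ENNReal.ofReal ((10 : ℝ) ^ d) ≠ 0 := by simp
  rw [← ENNReal.mul_le_mul_iff_right h10 ENNReal.ofReal_ne_top,
    ← ENNReal.ofReal_mul (by positivity), ← mul_pow]
  convert hmeas using 3
  ring

variable [BorelSpace X]

/-- Disjoint balls which are hit by comparatively large balls of the cover have small total
volume. -/
lemma tsum_pow_le_of_hit_by_large (hd : t ≤ d) (ht : 0 < t)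
    (hlow : ∀ (z : X) (δ : ℝ), 0 ≤ δ → δ ≤ 1 → ENNReal.ofReal (δ ^ d) ≤ μ (closedBall z δ))
    (hup : ∀ (z : X) (δ : ℝ), 0 ≤ δ → μ (closedBall z δ) ≤ ENNReal.ofReal ((2 * δ) ^ d))
    (hR : ∀ i, 0 < R i) {x : ℕ → X} {r w : ℕ → ℝ} {y : X} {ρ c : ℝ} {S : Set ℕ} (hc : 0 < c)
    (hmass : hitMass a R t y ρ ≤ ENNReal.ofReal (c ^ t))
    (hdisj : S.PairwiseDisjoint fun j => closedBall (x j) (r j))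
    (hr : ∀ j ∈ S, 0 < r j) (hr1 : ∀ j ∈ S, r j ≤ 1)
    (hsub : ∀ j ∈ S, dist (x j) y + r j ≤ ρ) (hw : ∀ j ∈ S, 2 * w j ≤ r j)
    (hlarge : ∀ j ∈ S, ∃ i, dist (x j) (a i) < w j + R i ∧ r j ≤ 4 * R i) :
    ∑' j : S, ENNReal.ofReal (r j ^ d) ≤ ENNReal.ofReal ((14 * c) ^ d) := by
  set I : Set ℕ := {i | dist y (a i) < ρ + R i} with hI
  have hcover : (⋃ j ∈ S, closedBall (x j) (r j)) ⊆ ⋃ i ∈ I, closedBall (a i) (7 * R i) := by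
    refine iUnion₂_subset fun j hj => ?_
    obtain ⟨i, hi, hri⟩ := hlarge j hj
    have h1 := hsub j hj
    have h2 := hw j hj
    have h3 := dist_triangle y (x j) (a i)
    rw [dist_comm y (x j)] at h3
    have h4 := hr j hj
    refine (closedBall_subset_closedBall' ?_).trans
      (subset_biUnion_of_mem (u := fun i => closedBall (a i) (7 * R i)) (?_ : i ∈ I))
    · linarith
    · simp only [hI, mem_ofPred_eq]
      linarith
  have hpow : ∀ i ∈ I, (2 * (7 * R i)) ^ d ≤ 14 ^ d * c ^ (d - t) * R i ^ t := by
    intro i hi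
    have h1 : R i ≤ c := radius_le_of_hitMass_le hR ht hc.le hmass hi
    have h2 : R i ^ d = R i ^ (d - t) * R i ^ t := by
      rw [← Real.rpow_add (hR i), sub_add_cancel, Real.rpow_natCast]
    have h3 : R i ^ (d - t) ≤ c ^ (d - t) :=
      Real.rpow_le_rpow (hR i).le h1 (sub_nonneg.2 hd)
    rw [show 2 * (7 * R i) = 14 * R i by ring, mul_pow, h2, mul_assoc]
    have := Real.rpow_nonneg (hR i).le t
    gcongr
  calc ∑' j : S, ENNReal.ofReal (r j ^ d)
      ≤ ∑' j : S, μ (closedBall (x j) (r j)) :=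
        ENNReal.tsum_le_tsum fun j => hlow _ _ (hr j j.2).le (hr1 j j.2)
    _ = μ (⋃ j ∈ S, closedBall (x j) (r j)) :=
        (measure_biUnion S.to_countable hdisj fun j _ => isClosed_closedBall.measurableSet).symm
    _ ≤ μ (⋃ i ∈ I, closedBall (a i) (7 * R i)) := measure_mono hcover
    _ ≤ ∑' i : I, μ (closedBall (a i) (7 * R i)) := measure_biUnion_le μ I.to_countable _
    _ ≤ ∑' i : I, ENNReal.ofReal (14 ^ d * c ^ (d - t)) * ENNReal.ofReal (R i ^ t) := by
        refine ENNReal.tsum_le_tsum fun i => ?_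
        rw [← ENNReal.ofReal_mul (by positivity)]
        exact (hup _ _ (by linarith [hR i])).trans (ENNReal.ofReal_le_ofReal (hpow i i.2))
    _ = ENNReal.ofReal (14 ^ d * c ^ (d - t)) * hitMass a R t y ρ := ENNReal.tsum_mul_left
    _ ≤ ENNReal.ofReal (14 ^ d * c ^ (d - t)) * ENNReal.ofReal (c ^ t) := by gcongr
    _ = ENNReal.ofReal ((14 * c) ^ d) := by
        rw [← ENNReal.ofReal_mul (by positivity), mul_assoc, ← Real.rpow_add hc, sub_add_cancel,
          Real.rpow_natCast, mul_pow]

/-- If a cover hits a ball with small mass, then it also hits with small mass one of the shrunk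
balls `closedBall (x j) (w j)` inside it. -/
lemma exists_hitMass_le (hd0 : d ≠ 0) (hd : t ≤ d) (ht : 0 < t)
    (hlow : ∀ (z : X) (δ : ℝ), 0 ≤ δ → δ ≤ 1 → ENNReal.ofReal (δ ^ d) ≤ μ (closedBall z δ))
    (hup : ∀ (z : X) (δ : ℝ), 0 ≤ δ → μ (closedBall z δ) ≤ ENNReal.ofReal ((2 * δ) ^ d))
    {x : ℕ → X} {r w : ℕ → ℝ} (hr : ∀ j, 0 < r j) (hrlim : Tendsto r atTop (𝓝 0))
    (hfull : μ ((⋂ k, ⋃ j, ⋃ (_ : k ≤ j), ball (x j) (r j))ᶜ) = 0)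
    (hw0 : ∀ j, 0 < w j) (hw : ∀ᶠ j in atTop, 2 * w j ≤ r j)
    (hrw : ∀ η : ℝ, 0 < η → ∀ᶠ j in atTop, r j ^ d ≤ η * w j ^ t)
    (hR : ∀ i, 0 < R i) {y : X} {ρ : ℝ} (hρ : 0 < ρ) (hρ1 : ρ ≤ 1)
    (hmass : hitMass a R t y ρ ≤ ENNReal.ofReal ((ρ / 560) ^ t)) (k : ℕ) :
    ∃ j, k ≤ j ∧ 2 * w j ≤ r j ∧ dist (x j) y + r j ≤ ρ ∧
      hitMass a R t (x j) (w j) ≤ ENNReal.ofReal ((w j / 560) ^ t) := by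
  set η : ℝ := (ρ / 20) ^ d / 4 / (ρ / 560) ^ t with hη
  have hη0 : 0 < η := by positivity
  have hev : ∀ᶠ j in atTop, k ≤ j ∧ 4 * r j ≤ ρ ∧ 2 * w j ≤ r j ∧
      r j ^ d ≤ η * (w j / 560) ^ t := by
    have h1 : ∀ᶠ j in atTop, r j < ρ / 4 := hrlim.eventually_lt_const (by positivity)
    have h2 := hrw (η * (1 / 560) ^ t) (by positivity)
    filter_upwards [eventually_ge_atTop k, h1, hw, h2] with j hk h1 hw h2
    refine ⟨hk, by linarith, hw, ?_⟩
    rwa [div_eq_inv_mul, Real.mul_rpow (by norm_num) (hw0 j).le, ← one_div, ← mul_assoc]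
  obtain ⟨N, hN⟩ := eventually_atTop.1 hev
  obtain ⟨S, hSN, hsub, hdisj, hsum⟩ := exists_disjoint_subfamily_tsum_ge hlow hup hr hfull y hρ
    hρ1 (fun j hj => (hN j hj).2.1)
  by_contra! hcon
  have hbig : ∀ j ∈ S, ENNReal.ofReal ((w j / 560) ^ t) ≤ hitMass a R t (x j) (w j) := by
    intro j hj
    obtain ⟨h1, -, h2, -⟩ := hN j (hSN j hj)
    exact (hcon j h1 h2 (hsub j hj)).le
  set P : ℕ → Prop := fun j => ∃ i, dist (x j) (a i) < w j + R i ∧ r j ≤ 4 * R i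
  have hlarge : ∑' j : {j ∈ S | P j}, ENNReal.ofReal (r j ^ d) ≤
      ENNReal.ofReal ((14 * (ρ / 560)) ^ d) :=
    tsum_pow_le_of_hit_by_large (w := w) hd ht hlow hup hR (by positivity) hmass
      (hdisj.subset fun j hj => hj.1) (fun j _ => hr j)
      (fun j hj => by linarith [(hN j (hSN j hj.1)).2.1, hr j])
      (fun j hj => hsub j hj.1) (fun j hj => (hN j (hSN j hj.1)).2.2.1) (fun j hj => hj.2)
  have hsmall : ∑' j : {j ∈ S | ¬ P j}, ENNReal.ofReal (r j ^ d) ≤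
      ENNReal.ofReal ((ρ / 20) ^ d / 4) := calc
    _ ≤ ∑' j : {j ∈ S | ¬ P j}, ENNReal.ofReal η * hitMass a R t (x j) (w j) := by
        refine ENNReal.tsum_le_tsum fun j => ?_
        refine (ENNReal.ofReal_le_ofReal (hN j (hSN j j.2.1)).2.2.2).trans ?_
        rw [ENNReal.ofReal_mul hη0.le]
        gcongr
        exact hbig j j.2.1
    _ = ENNReal.ofReal η * ∑' j : {j ∈ S | ¬ P j}, hitMass a R t (x j) (w j) :=
        ENNReal.tsum_mul_left
    _ ≤ ENNReal.ofReal η * ENNReal.ofReal ((ρ / 560) ^ t) := by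
        gcongr
        refine (tsum_hitMass_le (hdisj.subset fun j hj => hj.1) (fun j hj => hsub j hj.1)
          (fun j hj => (hN j (hSN j hj.1)).2.2.1) fun j hj i hi => ?_).trans hmass
        by_contra! h
        exact hj.2 ⟨i, hi, h⟩
    _ = ENNReal.ofReal ((ρ / 20) ^ d / 4) := by
        rw [← ENNReal.ofReal_mul hη0.le, hη, div_mul_cancel₀ _ (by positivity)]
  have hunion : S = {j ∈ S | P j} ∪ {j ∈ S | ¬ P j} := by
    ext j
    by_cases h : P j <;> simp [h]
  rw [hunion] at hsum
  have htotal := (hsum.trans (ENNReal.tsum_union_le (fun j => ENNReal.ofReal (r j ^ d)) _ _)).trans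
    (add_le_add hlarge hsmall)
  rw [← ENNReal.ofReal_add (by positivity) (by positivity),
    ENNReal.ofReal_le_ofReal_iff (by positivity)] at htotal
  have h1 : (14 * (ρ / 560)) ^ d = (1 / 2) ^ d * (ρ / 20) ^ d := by
    rw [← mul_pow]
    ring_nf
  have h2 : (1 / 2 : ℝ) ^ d ≤ 1 / 2 := pow_le_of_le_one (by norm_num) (by norm_num) hd0
  have h3 : 0 < (ρ / 20) ^ d := by positivity
  rw [h1] at htotal
  nlinarith

/-- The limsup of the shrunk balls cannot be covered by balls of small total mass. -/
lemma not_limsup_subset_iUnion_ball [CompactSpace X] [Nonempty X]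
    (hd0 : d ≠ 0) (hd : t ≤ d) (ht : 0 < t)
    (hlow : ∀ (z : X) (δ : ℝ), 0 ≤ δ → δ ≤ 1 → ENNReal.ofReal (δ ^ d) ≤ μ (closedBall z δ))
    (hup : ∀ (z : X) (δ : ℝ), 0 ≤ δ → μ (closedBall z δ) ≤ ENNReal.ofReal ((2 * δ) ^ d))
    {x : ℕ → X} {r w : ℕ → ℝ} (hr : ∀ j, 0 < r j) (hrlim : Tendsto r atTop (𝓝 0))
    (hfull : μ ((⋂ k, ⋃ j, ⋃ (_ : k ≤ j), ball (x j) (r j))ᶜ) = 0)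
    (hw0 : ∀ j, 0 < w j) (hw : ∀ᶠ j in atTop, 2 * w j ≤ r j)
    (hrw : ∀ η : ℝ, 0 < η → ∀ᶠ j in atTop, r j ^ d ≤ η * w j ^ t)
    (hR : ∀ i, 0 < R i)
    (hmass : ∑' i, ENNReal.ofReal (R i ^ t) ≤ ENNReal.ofReal ((1 / 560) ^ t)) :
    ¬ (⋂ k, ⋃ j, ⋃ (_ : k ≤ j), closedBall (x j) (w j)) ⊆ ⋃ i, ball (a i) (R i) := by
  intro hcover
  let Good : X × ℝ → Prop := fun p => 0 < p.2 ∧ p.2 ≤ 1 ∧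
    hitMass a R t p.1 p.2 ≤ ENNReal.ofReal ((p.2 / 560) ^ t)
  have hstep : ∀ (n : ℕ) (p : {p // Good p}), ∃ q : {p // Good p},
      (∃ j, n ≤ j ∧ q.1 = (x j, w j)) ∧ dist q.1.1 p.1.1 + q.1.2 ≤ p.1.2 ∧
        q.1.2 ≤ p.1.2 / 2 := by
    rintro n ⟨⟨y, ρ⟩, hρ, hρ1, hm⟩
    obtain ⟨j, hnj, hwj, hsub, hj⟩ := exists_hitMass_le hd0 hd ht hlow hup hr hrlim hfull hw0 hw
      hrw hR hρ hρ1 hm n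
    dsimp only at hρ hρ1 hm hsub
    have h0 := hr j
    have h1 := hw0 j
    have h2 := dist_nonneg (x := x j) (y := y)
    refine ⟨⟨(x j, w j), h1, by dsimp only; linarith, hj⟩, ⟨j, hnj, rfl⟩, ?_, ?_⟩
    · dsimp only; linarith
    · dsimp only; linarith
  choose next hnext_mem hnext_sub hnext_half using hstep
  obtain ⟨y₀⟩ := ‹Nonempty X›
  have hstart : Good (y₀, 1) := by
    refine ⟨one_pos, le_rfl, le_trans ?_ hmass⟩
    exact ENNReal.tsum_comp_le_tsum_of_injective Subtype.val_injective
      fun i => ENNReal.ofReal (R i ^ t)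
  let p : ℕ → {p // Good p} := fun n => Nat.rec ⟨(y₀, 1), hstart⟩ next n
  have hp : ∀ n, p (n + 1) = next n (p n) := fun n => rfl
  have hhalf : ∀ n, (p n).1.2 ≤ (1 / 2) ^ n := by
    intro n
    induction n with
    | zero => simp [p]
    | succ n ih =>
      have := hnext_half n (p n)
      rw [← hp] at this
      rw [pow_succ]
      linarith
  obtain ⟨z, hz⟩ : (⋂ n, closedBall (p n).1.1 (p n).1.2).Nonempty := by
    refine IsCompact.nonempty_iInter_of_sequence_nonempty_isCompact_isClosed _ (fun n => ?_)
      (fun n => nonempty_closedBall.2 (p n).2.1.le) isClosed_closedBall.isCompact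
      fun n => isClosed_closedBall
    refine closedBall_subset_closedBall' ?_
    have := hnext_sub n (p n)
    rw [← hp] at this
    linarith
  rw [mem_iInter] at hz
  have hzE : z ∈ ⋂ k, ⋃ j, ⋃ (_ : k ≤ j), closedBall (x j) (w j) := by
    refine mem_iInter.2 fun k => ?_
    obtain ⟨j, hkj, hj⟩ := hnext_mem k (p k)
    rw [← hp] at hj
    have := hz (k + 1)
    rw [hj] at this
    exact mem_iUnion₂.2 ⟨j, hkj, this⟩
  obtain ⟨i, hi⟩ := mem_iUnion.1 (hcover hzE)
  have hle : ∀ n, R i ≤ (1 / 2) ^ n := by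
    intro n
    obtain ⟨h0, -, hm⟩ := (p n).2
    have h1 := hz n
    rw [mem_closedBall, dist_comm] at h1
    have h2 : dist (p n).1.1 (a i) < (p n).1.2 + R i := by
      linarith [dist_triangle (p n).1.1 z (a i), mem_ball.1 hi]
    have := radius_le_of_hitMass_le hR ht (by positivity) hm h2
    linarith [hhalf n]
  have hlim : Tendsto (fun n : ℕ => (1 / 2 : ℝ) ^ n) atTop (𝓝 0) :=
    tendsto_pow_atTop_nhds_zero_of_lt_one (by norm_num) (by norm_num)
  exact (hR i).not_ge (ge_of_tendsto' hlim hle)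

/-- A set of zero Hausdorff measure is covered by balls of arbitrarily small total mass. -/
lemma exists_ball_cover_of_hausdorffMeasure_eq_zero [Nonempty X] (ht : 0 < t) {E : Set X}
    (hE : Measure.hausdorffMeasure t E = 0) {ε : ℝ≥0∞} (hε : ε ≠ 0) :
    ∃ (a : ℕ → X) (R : ℕ → ℝ), (∀ i, 0 < R i) ∧ E ⊆ ⋃ i, ball (a i) (R i) ∧
      ∑' i, ENNReal.ofReal (R i ^ t) ≤ ε := by
  obtain ⟨A, hEA, hA⟩ : ∃ A : ℕ → Set X, E ⊆ ⋃ n, A n ∧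
      ∑' n, ⨆ _ : (A n).Nonempty, ediam (A n) ^ t < ε / 2 := by
    have hlt : Measure.hausdorffMeasure t E < ε / 2 := by
      rw [hE]
      exact ENNReal.half_pos hε
    rw [Measure.hausdorffMeasure_apply] at hlt
    have h1 := (le_iSup₂ (f := fun (r : ℝ≥0∞) (_ : 0 < r) =>
      ⨅ (A : ℕ → Set X) (_ : E ⊆ ⋃ n, A n) (_ : ∀ n, ediam (A n) ≤ r),
        ∑' n, ⨆ _ : (A n).Nonempty, ediam (A n) ^ t) 1 one_pos).trans_lt hlt
    simp only [iInf_lt_iff] at h1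
    obtain ⟨A, hEA, -, hA⟩ := h1
    exact ⟨A, hEA, hA⟩
  obtain ⟨δ, hδ0, hδ⟩ := ENNReal.exists_pos_sum_of_countable (ENNReal.half_pos hε).ne' ℕ
  have hball : ∀ n, ∃ (b : X) (s : ℝ), 0 < s ∧ A n ⊆ ball b s ∧
      ENNReal.ofReal (s ^ t) ≤ (⨆ _ : (A n).Nonempty, ediam (A n) ^ t) + δ n := by
    intro n
    set m : ℝ≥0∞ := ⨆ _ : (A n).Nonempty, ediam (A n) ^ t with hm
    have hmtop : m ≠ ∞ := ne_top_of_lt <|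
      ((ENNReal.le_tsum (f := fun n => ⨆ _ : (A n).Nonempty, ediam (A n) ^ t) n).trans_lt hA)
    set q : ℝ := m.toReal + δ n with hq
    have hq0 : 0 < q := by
      have := hδ0 n
      positivity
    have hqm : ENNReal.ofReal q = m + δ n := by
      rw [hq, ENNReal.ofReal_add ENNReal.toReal_nonneg (δ n).coe_nonneg, ENNReal.ofReal_toReal hmtop,
        ENNReal.ofReal_coe_nnreal]
    have hqt : (q ^ t⁻¹) ^ t = q := by
      rw [← Real.rpow_mul hq0.le, inv_mul_cancel₀ ht.ne', Real.rpow_one]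
    rcases (A n).eq_empty_or_nonempty with hempty | ⟨b, hb⟩
    · exact ⟨Classical.arbitrary X, q ^ t⁻¹, by positivity, by simp [hempty],
        by rw [hqt, hqm]⟩
    · refine ⟨b, q ^ t⁻¹, by positivity, fun z hz => ?_, by rw [hqt, hqm]⟩
      have h1 : edist z b ^ t ≤ m := by
        rw [hm, iSup_pos ⟨b, hb⟩]
        exact ENNReal.rpow_le_rpow (edist_le_ediam_of_mem hz hb) ht.le
      have h2 : edist z b ^ t < ENNReal.ofReal (q ^ t⁻¹) ^ t := by
        rw [ENNReal.ofReal_rpow_of_pos (by positivity), hqt, hqm]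
        exact h1.trans_lt (ENNReal.lt_add_right hmtop (by simpa using (hδ0 n).ne'))
      rw [ENNReal.rpow_lt_rpow_iff ht, edist_lt_ofReal] at h2
      exact h2
  choose b s hs hAs hmass using hball
  refine ⟨b, s, hs, hEA.trans (iUnion_mono hAs), ?_⟩
  calc ∑' n, ENNReal.ofReal (s n ^ t)
      ≤ ∑' n, ((⨆ _ : (A n).Nonempty, ediam (A n) ^ t) + (δ n : ℝ≥0∞)) :=
        ENNReal.tsum_le_tsum hmass
    _ = (∑' n, ⨆ _ : (A n).Nonempty, ediam (A n) ^ t) + ∑' n, (δ n : ℝ≥0∞) := ENNReal.tsum_add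
    _ ≤ ε / 2 + ε / 2 := add_le_add hA.le hδ.le
    _ = ε := ENNReal.add_halves ε

end BallCovers

lemma Torus.volume_closedBall {d : ℕ} (z : Torus d) {δ : ℝ} (hδ : 0 ≤ δ) :
    volume (closedBall z δ) = ENNReal.ofReal (min 1 (2 * δ) ^ d) := by
  rw [volume_pi_closedBall z hδ]
  simp [AddCircle.volume_closedBall, ENNReal.ofReal_pow (le_min zero_le_one
    (mul_nonneg zero_le_two hδ))]

/-- Shrinking radii by a power beats the loss from lowering the exponent. -/
lemma eventually_pow_le_mul_rpow {d : ℕ} (hd : 0 < d) {s t : ℝ} (hs : 0 < s) (hts : t < s)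
    {r : ℕ → ℝ} (hr : ∀ j, 0 < r j) (hrlim : Tendsto r atTop (𝓝 0)) {η : ℝ} (hη : 0 < η) :
    ∀ᶠ j in atTop, r j ^ d ≤ η * (r j ^ ((d : ℝ) / s) / 2) ^ t := by
  have hd' : (0 : ℝ) < d := Nat.cast_pos.2 hd
  set e : ℝ := d - d / s * t with he
  have he0 : 0 < e := by
    have : d / s * t < d / s * s := by gcongr
    rw [div_mul_cancel₀ _ hs.ne'] at this
    linarith
  have hlim : Tendsto (fun j => r j ^ e) atTop (𝓝 0) := by
    simpa [Real.zero_rpow he0.ne'] using hrlim.rpow_const (Or.inr he0.le)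
  filter_upwards [hlim.eventually_lt_const (show 0 < η * (1 / 2) ^ t by positivity)] with j hj
  have h1 : r j ^ d = r j ^ e * r j ^ ((d : ℝ) / s * t) := by
    rw [← Real.rpow_add (hr j), he, sub_add_cancel, Real.rpow_natCast]
  have h2 : (r j ^ ((d : ℝ) / s) / 2) ^ t = (1 / 2) ^ t * r j ^ ((d : ℝ) / s * t) := by
    rw [Real.rpow_mul (hr j).le, ← Real.mul_rpow (by norm_num) (Real.rpow_nonneg (hr j).le _)]
    ring_nf
  rw [h1, h2, ← mul_assoc]
  have := Real.rpow_nonneg (hr j).le ((d : ℝ) / s * t)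
  gcongr

/-- **Corollary (classical mass transference principle), dimension part.**
If `limsup B(x_j, r_j)` has full Lebesgue measure in the torus and `0 ≤ s ≤ d`, then
`dim_H (limsup B(x_j, r_j^{d/s})) ≥ s`. -/
theorem mass_transference_balls_dimension
    (d : ℕ) (hd : 0 < d)
    (x : ℕ → Torus d) (r : ℕ → ℝ) (hr : ∀ j, 0 < r j)
    (hrlim : Tendsto r atTop (𝓝 0))
    (hfull : volume ((⋂ k, ⋃ j, ⋃ (_ : k ≤ j), ball (x j) (r j))ᶜ) = 0)
    (s : ℝ) (hs0 : 0 ≤ s) (hsd : s ≤ d) :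
    ENNReal.ofReal s ≤
      dimH (⋂ k, ⋃ j, ⋃ (_ : k ≤ j), ball (x j) (r j ^ ((d : ℝ) / s))) := by
  refine ENNReal.le_of_forall_nnreal_lt fun t hts => ?_
  rcases eq_zero_or_pos t with rfl | ht0
  · simp
  have ht : (0 : ℝ) < t := ht0
  have hts' : (t : ℝ) < s := by
    rwa [← ENNReal.ofReal_coe_nnreal, ENNReal.ofReal_lt_ofReal_iff_of_nonneg t.coe_nonneg] at hts
  have hs : 0 < s := ht.trans hts'
  refine le_dimH_of_hausdorffMeasure_ne_zero fun hzero => ?_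
  have hε : ENNReal.ofReal ((1 / 560 : ℝ) ^ (t : ℝ)) ≠ 0 :=
    (ENNReal.ofReal_pos.2 (by positivity)).ne'
  obtain ⟨a, R, hR, hcover, hmass⟩ := exists_ball_cover_of_hausdorffMeasure_eq_zero ht hzero hε
  have hpos : ∀ j, 0 < r j ^ ((d : ℝ) / s) := fun j => Real.rpow_pos_of_pos (hr j) _
  refine not_limsup_subset_iUnion_ball (μ := (volume : Measure (Torus d))) hd.ne'
    (hts'.le.trans hsd) ht ?_ ?_ hr hrlim hfull (w := fun j => r j ^ ((d : ℝ) / s) / 2)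
    (fun j => half_pos (hpos j)) ?_
    (fun η hη => eventually_pow_le_mul_rpow hd hs hts' hr hrlim hη) hR hmass
    (Subset.trans ?_ hcover)
  · intro z δ h0 h1
    rw [Torus.volume_closedBall z h0]
    gcongr
    exact le_min h1 (by linarith)
  · intro z δ h0
    rw [Torus.volume_closedBall z h0]
    gcongr
    exact min_le_right _ _
  · filter_upwards [hrlim.eventually_lt_const one_pos] with j hj
    have := Real.rpow_le_rpow_of_exponent_ge (hr j) hj.le ((one_le_div hs).2 hsd)
    rw [Real.rpow_one] at this
    linarith
  · exact iInter_mono fun k => iUnion₂_mono fun j _ =>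
      closedBall_subset_ball (half_lt_self (hpos j))
end
end
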